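/- arXiv:2404.02021 — 2 statements merged into one kernel-verified Lean document; each statement's English description precedes it below -/
import Mathlib

section
/- For all sufficiently large integers k, there exists a linear 3-graph F on k vertices and a constant c > 0 depending only on k such that for all n ≥ 3, r(F, K_n^(3)) > 2^{c (log n)^{√k/(128 (log k)^5)}} (log denotes the natural logarithm). -/
/-- A 3-uniform hypergraph on a finite subset of `ℕ`. -/
structure ThreeGraph where
  verts : Finset ℕ
  edges : Finset (Finset ℕ)
  card_eq : ∀ e ∈ edges, e.card = 3
  subset_verts : ∀ e ∈ edges, e ⊆ verts

/-- `χ` (on 3-element subsets of `{0, …, N-1}`) contains a copy of `H` in color `c`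
(`true` = red, `false` = blue). -/
def hasMonoCopy (N : ℕ) (χ : Finset ℕ → Bool) (H : ThreeGraph) (c : Bool) : Prop :=
  ∃ φ : ℕ → ℕ, Set.InjOn φ ↑H.verts ∧ (∀ v ∈ H.verts, φ v < N) ∧
    ∀ e ∈ H.edges, χ (e.image φ) = c

/-- The Ramsey number `r(G, H)`: the least `N` such that every red/blue coloring of the
triples of an `N`-element set contains a red copy of `G` or a blue copy of `H`. -/
noncomputable def ramsey (G H : ThreeGraph) : ℕ :=
  sInf {N : ℕ | ∀ χ : Finset ℕ → Bool,
    hasMonoCopy N χ G true ∨ hasMonoCopy N χ H false}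

/-- The complete tripartite 3-graph `K_{a,b,c}^{(3)}`. -/
def tripartite (a b c : ℕ) : ThreeGraph where
  verts := Finset.range (a + b + c)
  edges := ((Finset.range (a + b + c)).powersetCard 3).filter (fun e =>
    (e.filter (fun x => x < a)).card = 1 ∧
    (e.filter (fun x => a ≤ x ∧ x < a + b)).card = 1 ∧
    (e.filter (fun x => a + b ≤ x)).card = 1)
  card_eq := fun e he => (Finset.mem_powersetCard.mp (Finset.mem_filter.mp he).1).2
  subset_verts := fun e he => (Finset.mem_powersetCard.mp (Finset.mem_filter.mp he).1).1

/-- The complete 3-graph `K_n^{(3)}`. -/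
def completeTG (n : ℕ) : ThreeGraph where
  verts := Finset.range n
  edges := (Finset.range n).powersetCard 3
  card_eq := fun e he => (Finset.mem_powersetCard.mp he).2
  subset_verts := fun e he => (Finset.mem_powersetCard.mp he).1

/-- The shadow of a set of 3-edges: all 2-element subsets of its edges. -/
def shadowOf (E : Finset (Finset ℕ)) : Finset (Finset ℕ) :=
  E.biUnion (fun e => e.powersetCard 2)

/-- An oriented 3-graph (given by its edge set of ordered triples): it contains at most one of
the six coordinate permutations of any ordered triple and no triple with a repeated
coordinate. -/
def Oriented (E : Set (ℕ × ℕ × ℕ)) : Prop :=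
  ∀ a b c : ℕ, (a, b, c) ∈ E →
    (a ≠ b ∧ b ≠ c ∧ a ≠ c) ∧
    (a, c, b) ∉ E ∧ (b, a, c) ∉ E ∧ (b, c, a) ∉ E ∧ (c, a, b) ∉ E ∧ (c, b, a) ∉ E

/-- `f` is a pair homomorphism from `H`, ordered by the (injective on `V(H)`) function `ord`,
to the oriented 3-graph with edge set `E`. -/
def IsPairHom (H : ThreeGraph) (ord : ℕ → ℕ) (E : Set (ℕ × ℕ × ℕ))
    (f : Finset ℕ → ℕ) : Prop :=
  Set.InjOn ord ↑H.verts ∧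
  ∀ e ∈ H.edges, ∀ u v w : ℕ, e = {u, v, w} → ord u < ord v → ord v < ord w →
    (f {u, v} ≠ f {v, w} ∧ f {v, w} ≠ f {u, w} ∧ f {u, v} ≠ f {u, w}) ∧
    (f {u, v}, f {v, w}, f {u, w}) ∈ E

/-- `v(f(H'))` for the subhypergraph with edge set `E'`: the number of vertices of the image,
i.e. the size of the image of the shadow of `E'` under `f`. -/
def imageVerts (f : Finset ℕ → ℕ) (E' : Finset (Finset ℕ)) : ℕ :=
  ((shadowOf E').image f).card

/-- `e(f(H'))` for the subhypergraph with edge set `E'`: the number of distinct image triples. -/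
noncomputable def imageEdges (ord : ℕ → ℕ) (f : Finset ℕ → ℕ)
    (E' : Finset (Finset ℕ)) : ℕ :=
  Set.ncard {p : ℕ × ℕ × ℕ | ∃ e ∈ E', ∃ u v w : ℕ,
    e = ({u, v, w} : Finset ℕ) ∧ ord u < ord v ∧ ord v < ord w ∧
    p = (f {u, v}, f {v, w}, f {u, w})}

/-- The pair density `m_pair(H)`: the minimum, over all orderings of `V(H)` and all pair
homomorphisms `f` from `H` to any oriented 3-graph, of the maximum over all nonempty
subhypergraphs `H' ⊆ H` of `e(f(H')) / v(f(H'))`. -/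
noncomputable def mpair (H : ThreeGraph) : ℝ :=
  sInf {q : ℝ | ∃ (ord : ℕ → ℕ) (E : Set (ℕ × ℕ × ℕ)) (f : Finset ℕ → ℕ),
    Oriented E ∧ IsPairHom H ord E f ∧
    q = sSup {r : ℝ | ∃ E' : Finset (Finset ℕ), E' ⊆ H.edges ∧ E'.Nonempty ∧
      r = (imageEdges ord f E' : ℝ) / (imageVerts f E' : ℝ)}}

/-- The set of 3-edges `E` contains a Berge cycle: `t ≥ 2` distinct vertices and `t` distinct
edges with `v i, v (i+1) ∈ e i` cyclically. -/
def HasBergeCycle (E : Set (Finset ℕ)) : Prop :=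
  ∃ t : ℕ, 2 ≤ t ∧ ∃ (v : ZMod t → ℕ) (e : ZMod t → Finset ℕ),
    Function.Injective v ∧ Function.Injective e ∧
    ∀ i : ZMod t, e i ∈ E ∧ v i ∈ e i ∧ v (i + 1) ∈ e i

/-- `H` is avoidable: for every ordering and every pair homomorphism `f` from `H` to an
oriented 3-graph, the 3-graph of underlying vertex sets of the image edges has a Berge cycle. -/
def Avoidable (H : ThreeGraph) : Prop :=
  ∀ (ord : ℕ → ℕ) (E : Set (ℕ × ℕ × ℕ)) (f : Finset ℕ → ℕ),
    Oriented E → IsPairHom H ord E f →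
    HasBergeCycle {s : Finset ℕ | ∃ e ∈ H.edges, ∃ u v w : ℕ,
      e = ({u, v, w} : Finset ℕ) ∧ ord u < ord v ∧ ord v < ord w ∧
      s = ({f {u, v}, f {v, w}, f {u, w}} : Finset ℕ)}

/-- A linear 3-graph: any two distinct edges share at most one vertex. -/
def LinearTG (F : ThreeGraph) : Prop :=
  ∀ e₁ ∈ F.edges, ∀ e₂ ∈ F.edges, e₁ ≠ e₂ → (e₁ ∩ e₂).card ≤ 1


theorem ramsey_fin (r : ℕ) : ∀ s t : ℕ, ∃ N : ℕ, ∀ V : Finset ℕ, N ≤ V.card →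
    ∀ χ : Finset ℕ → Bool,
      (∃ S ⊆ V, S.card = s ∧ ∀ e ⊆ S, e.card = r → χ e = true) ∨
      (∃ S ⊆ V, S.card = t ∧ ∀ e ⊆ S, e.card = r → χ e = false) := by
  induction r with
  | zero =>
    intro s t
    refine ⟨max s t, fun V hV χ => ?_⟩
    cases h : χ ∅ with
    | true =>
      left
      obtain ⟨S, hS, hc⟩ := Finset.exists_subset_card_eq (le_trans (le_max_left s t) hV)
      refine ⟨S, hS, hc, fun e _ he => ?_⟩
      rw [Finset.card_eq_zero.mp he, h]
    | false =>
      right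
      obtain ⟨S, hS, hc⟩ := Finset.exists_subset_card_eq (le_trans (le_max_right s t) hV)
      refine ⟨S, hS, hc, fun e _ he => ?_⟩
      rw [Finset.card_eq_zero.mp he, h]
  | succ r ih =>
    intro s
    induction s with
    | zero =>
      intro t
      refine ⟨0, fun V _ χ => Or.inl ⟨∅, by simp, rfl, fun e he hc => ?_⟩⟩
      rw [Finset.subset_empty.mp he] at hc
      simp at hc
    | succ s ihs =>
      intro t
      induction t with
      | zero =>
        refine ⟨0, fun V _ χ => Or.inr ⟨∅, by simp, rfl, fun e he hc => ?_⟩⟩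
        rw [Finset.subset_empty.mp he] at hc
        simp at hc
      | succ t iht =>
        obtain ⟨N1, h1⟩ := ihs (t + 1)
        obtain ⟨N2, h2⟩ := iht
        obtain ⟨N, hN⟩ := ih N1 N2
        refine ⟨N + 1, fun V hV χ => ?_⟩
        obtain ⟨v, hv⟩ : V.Nonempty := Finset.card_pos.mp (by omega)
        have hc : N ≤ (V.erase v).card := by rw [Finset.card_erase_of_mem hv]; omega
        -- extension of a homogeneous set by v
        have ext : ∀ (c : Bool) (S S' : Finset ℕ), S ⊆ V.erase v → S' ⊆ S →
            (∀ e ⊆ S, e.card = r → χ (insert v e) = c) →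
            (∀ e ⊆ S', e.card = r + 1 → χ e = c) →
            ∀ e ⊆ insert v S', e.card = r + 1 → χ e = c := by
          intro c S S' hS hS' ha hb e he hec
          by_cases hve : v ∈ e
          · have := ha (e.erase v) (fun x hx => hS' (by
              have h1 := he (Finset.mem_of_mem_erase hx)
              have h2 := Finset.ne_of_mem_erase hx
              simpa [h2] using h1)) (by rw [Finset.card_erase_of_mem hve]; omega)
            rwa [Finset.insert_erase hve] at this
          · exact hb e (fun x hx => by
              have h1 := he hx
              have h2 : x ≠ v := fun h => hve (h ▸ hx)
              simpa [h2] using h1) hec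
        rcases hN (V.erase v) hc (fun e => χ (insert v e)) with ⟨S, hS, hSc, hSe⟩ | ⟨S, hS, hSc, hSe⟩
        · rcases h1 S hSc.ge χ with ⟨S', hS', hc', he'⟩ | ⟨S', hS', hc', he'⟩
          · left
            have hvS : v ∉ S' := fun h => by simpa using hS (hS' h)
            refine ⟨insert v S', ?_, by rw [Finset.card_insert_of_notMem hvS, hc'], ext true S S' hS hS' hSe he'⟩
            intro x hx
            rcases Finset.mem_insert.mp hx with rfl | hx
            · exact hv
            · exact Finset.mem_of_mem_erase (hS (hS' hx))
          · right
            exact ⟨S', fun x hx => Finset.mem_of_mem_erase (hS (hS' hx)), hc', he'⟩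
        · rcases h2 S hSc.ge χ with ⟨S', hS', hc', he'⟩ | ⟨S', hS', hc', he'⟩
          · left
            exact ⟨S', fun x hx => Finset.mem_of_mem_erase (hS (hS' hx)), hc', he'⟩
          · right
            have hvS : v ∉ S' := fun h => by simpa using hS (hS' h)
            refine ⟨insert v S', ?_, by rw [Finset.card_insert_of_notMem hvS, hc'], ext false S S' hS hS' hSe he'⟩
            intro x hx
            rcases Finset.mem_insert.mp hx with rfl | hx
            · exact hv
            · exact Finset.mem_of_mem_erase (hS (hS' hx))

/-- Height at which two numbers merge in the binary tree. -/
theorem hh_ex (u v : ℕ) : ∃ t, u / 2 ^ t = v / 2 ^ t := by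
  refine ⟨u + v, ?_⟩
  have h1 : u + v < 2 ^ (u + v) := Nat.lt_two_pow_self
  rw [Nat.div_eq_of_lt (by omega), Nat.div_eq_of_lt (by omega)]

def hh (u v : ℕ) : ℕ := Nat.find (hh_ex u v)

theorem hh_le_iff {u v t : ℕ} : hh u v ≤ t ↔ u / 2 ^ t = v / 2 ^ t := by
  constructor
  · intro h
    have h1 : u / 2 ^ (hh u v) = v / 2 ^ (hh u v) := Nat.find_spec (hh_ex u v)
    obtain ⟨s, rfl⟩ := Nat.exists_eq_add_of_le h
    rw [pow_add, ← Nat.div_div_eq_div_mul, ← Nat.div_div_eq_div_mul, h1]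
  · intro h
    exact Nat.find_le h

theorem hh_comm (u v : ℕ) : hh u v = hh v u := by
  apply le_antisymm
  · rw [hh_le_iff, eq_comm, ← hh_le_iff]
  · rw [hh_le_iff, eq_comm, ← hh_le_iff]

theorem hh_self (u : ℕ) : hh u u = 0 := by
  have : hh u u ≤ 0 := hh_le_iff.mpr rfl
  omega

theorem hh_eq_zero {u v : ℕ} (h : hh u v = 0) : u = v := by
  have : hh u v ≤ 0 := h.le
  rw [hh_le_iff] at this
  simpa using this

theorem hh_ultra (u v w : ℕ) : hh u w ≤ max (hh u v) (hh v w) := by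
  rw [hh_le_iff]
  have h1 : hh u v ≤ max (hh u v) (hh v w) := le_max_left _ _
  have h2 : hh v w ≤ max (hh u v) (hh v w) := le_max_right _ _
  rw [hh_le_iff] at h1 h2
  rw [h1, h2]

theorem hh_mono_left {u v w : ℕ} (h1 : u ≤ v) (h2 : v ≤ w) : hh u v ≤ hh u w := by
  rw [hh_le_iff]
  have h : hh u w ≤ hh u w := le_rfl
  rw [hh_le_iff] at h
  have a := Nat.div_le_div_right (c := 2 ^ hh u w) h1
  have b := Nat.div_le_div_right (c := 2 ^ hh u w) h2
  omega

theorem hh_mono_right {u v w : ℕ} (h1 : u ≤ v) (h2 : v ≤ w) : hh v w ≤ hh u w := by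
  rw [hh_le_iff]
  have h : hh u w ≤ hh u w := le_rfl
  rw [hh_le_iff] at h
  have a := Nat.div_le_div_right (c := 2 ^ hh u w) h1
  have b := Nat.div_le_div_right (c := 2 ^ hh u w) h2
  omega

theorem hh_max {u v w : ℕ} (h1 : u ≤ v) (h2 : v ≤ w) : hh u w = max (hh u v) (hh v w) :=
  le_antisymm (hh_ultra u v w) (max_le (hh_mono_left h1 h2) (hh_mono_right h1 h2))

theorem hh_ne {u v w : ℕ} (h1 : u < v) (h2 : v < w) : hh u v ≠ hh v w := by
  intro h
  have hw : hh u w = hh u v := by rw [hh_max h1.le h2.le, ← h, max_self]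
  cases ht : hh u v with
  | zero => have := hh_eq_zero ht; omega
  | succ t =>
    have e1 : ¬ hh u v ≤ t := by omega
    have e2 : ¬ hh v w ≤ t := by omega
    have e3 : hh u w ≤ t + 1 := by omega
    rw [hh_le_iff] at e1 e2 e3
    rw [pow_succ, ← Nat.div_div_eq_div_mul, ← Nat.div_div_eq_div_mul] at e3
    have a := Nat.div_le_div_right (c := 2 ^ t) h1.le
    have b := Nat.div_le_div_right (c := 2 ^ t) h2.le
    omega

theorem hh_le_of_lt {u v D : ℕ} (hu : u < 2 ^ D) (hv : v < 2 ^ D) : hh u v ≤ D := by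
  rw [hh_le_iff, Nat.div_eq_of_lt hu, Nat.div_eq_of_lt hv]

/-- red predicate -/
def redP (G : ℕ → ℕ → Prop) (s : Finset ℕ) : Prop :=
  ∃ u v w : ℕ, s = {u, v, w} ∧ u < v ∧ v < w ∧ hh u v < hh v w ∧ G (hh u v) (hh v w)

theorem redP_iff {G : ℕ → ℕ → Prop} {u v w : ℕ} (h1 : u < v) (h2 : v < w) :
    redP G {u, v, w} ↔ (hh u v < hh v w ∧ G (hh u v) (hh v w)) := by
  constructor
  · rintro ⟨a, b, c, he, h3, h4, h5, h6⟩
    have m1 : u ∈ ({a, b, c} : Finset ℕ) := by rw [← he]; simp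
    have m2 : v ∈ ({a, b, c} : Finset ℕ) := by rw [← he]; simp
    have m3 : w ∈ ({a, b, c} : Finset ℕ) := by rw [← he]; simp
    simp only [Finset.mem_insert, Finset.mem_singleton] at m1 m2 m3
    obtain ⟨rfl, rfl, rfl⟩ : u = a ∧ v = b ∧ w = c := by omega
    exact ⟨h5, h6⟩
  · rintro ⟨h5, h6⟩
    exact ⟨u, v, w, rfl, h1, h2, h5, h6⟩

/-- A blue clique is small. -/
theorem blue_clique_bound (G : ℕ → ℕ → Prop) (D l : ℕ)
    (hG : ∀ I ⊆ Finset.range (D + 1), I.card = l → ∃ i ∈ I, ∃ j ∈ I, i < j ∧ G i j)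
    (S : Finset ℕ) (hS : ∀ x ∈ S, x < 2 ^ D)
    (hblue : ∀ e ⊆ S, e.card = 3 → ¬ redP G e) : S.card ≤ (D + 2) ^ l := by
  classical
  let I : ℕ → Finset ℕ := fun a => (S.filter (fun w => a < w)).image (fun w => hh a w)
  have hI : ∀ a ∈ S, I a ⊆ Finset.range (D + 1) := by
    intro a ha i hi
    simp only [I, Finset.mem_image, Finset.mem_filter] at hi
    obtain ⟨w, ⟨hw, _⟩, rfl⟩ := hi
    have := hh_le_of_lt (hS a ha) (hS w hw)
    simp; omega
  have hind : ∀ a ∈ S, ∀ i ∈ I a, ∀ j ∈ I a, i < j → ¬ G i j := by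
    intro a ha i hi j hj hij hGij
    simp only [I, Finset.mem_image, Finset.mem_filter] at hi hj
    obtain ⟨v, ⟨hv, hav⟩, rfl⟩ := hi
    obtain ⟨w, ⟨hw, haw⟩, rfl⟩ := hj
    have hvw : v < w := by
      by_contra hc
      have := hh_mono_left haw.le (not_lt.mp hc)
      omega
    have hm := hh_max hav.le hvw.le
    have hm2 : hh v w = hh a w := by
      rcases le_total (hh a v) (hh v w) with h | h
      · rw [max_eq_right h] at hm; omega
      · rw [max_eq_left h] at hm; omega
    refine hblue {a, v, w} ?_ ?_ ?_
    · intro x hx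
      simp only [Finset.mem_insert, Finset.mem_singleton] at hx
      rcases hx with rfl | rfl | rfl <;> assumption
    · rw [Finset.card_eq_three]
      exact ⟨a, v, w, by omega, by omega, by omega, rfl⟩
    · rw [redP_iff hav hvw, hm2]
      exact ⟨hij, hGij⟩
  have hcard : ∀ a ∈ S, (I a).card < l := by
    intro a ha
    by_contra hc
    obtain ⟨J, hJ, hJc⟩ := Finset.exists_subset_card_eq (not_lt.mp hc)
    obtain ⟨i, hi, j, hj, hij, hg⟩ := hG J (hJ.trans (hI a ha)) hJc
    exact hind a ha i (hJ hi) j (hJ hj) hij hg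
  have hlt : ∀ a ∈ S, ∀ a' ∈ S, a < a' → I a ≠ I a' := by
    intro a ha a' ha' haa heq
    have h1 : hh a a' ∈ I a := by
      simp only [I, Finset.mem_image, Finset.mem_filter]
      exact ⟨a', ⟨ha', haa⟩, rfl⟩
    rw [heq] at h1
    simp only [I, Finset.mem_image, Finset.mem_filter] at h1
    obtain ⟨w, ⟨hw, haw⟩, he⟩ := h1
    exact hh_ne haa haw he.symm
  have hinj : Set.InjOn I S := by
    intro a ha a' ha' heq
    rcases lt_trichotomy a a' with h | h | h
    · exact absurd heq (hlt a ha a' ha' h)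
    · exact h
    · exact absurd heq.symm (hlt a' ha' a ha h)
  calc S.card = (S.image I).card := (Finset.card_image_of_injOn hinj).symm
    _ ≤ ((Finset.range l).biUnion (fun i => (Finset.range (D + 1)).powersetCard i)).card := by
        apply Finset.card_le_card
        intro J hJ
        obtain ⟨a, ha, rfl⟩ := Finset.mem_image.mp hJ
        simp only [Finset.mem_biUnion, Finset.mem_range, Finset.mem_powersetCard]
        exact ⟨(I a).card, hcard a ha, hI a ha, rfl⟩
    _ ≤ ∑ i ∈ Finset.range l, ((Finset.range (D + 1)).powersetCard i).card := Finset.card_biUnion_le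
    _ ≤ ∑ i ∈ Finset.range l, (D + 1) ^ i := by
        apply Finset.sum_le_sum
        intro i _
        rw [Finset.card_powersetCard, Finset.card_range]
        exact Nat.choose_le_pow _ _
    _ ≤ (D + 2) ^ l := by
        clear hG hcard
        induction l with
        | zero => simp
        | succ l ih =>
          rw [Finset.sum_range_succ, pow_succ]
          have h2 : (D + 1) ^ l ≤ (D + 2) ^ l := Nat.pow_le_pow_left (by omega) l
          nlinarith [Nat.zero_le ((D+2)^l), Nat.zero_le D]


theorem card_pi_le {ι α : Type*} [Fintype ι] [DecidableEq ι] [Fintype α] [DecidableEq α]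
    (T : Finset ι) (S : ι → Finset α) (ε : ℝ) 
    (h : ∀ p ∈ T, ((S p).card : ℝ) ≤ ε * Fintype.card α) :
    ((Finset.univ.filter (fun g : ι → α => ∀ p ∈ T, g p ∈ S p)).card : ℝ)
      ≤ ε ^ T.card * Fintype.card (ι → α) := by
  have e1 : Finset.univ.filter (fun g : ι → α => ∀ p ∈ T, g p ∈ S p) =
      Fintype.piFinset (fun p => if p ∈ T then S p else Finset.univ) := by
    ext g
    simp only [Finset.mem_filter, Finset.mem_univ, true_and, Fintype.mem_piFinset]
    refine forall_congr' (fun p => ?_)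
    by_cases hp : p ∈ T <;> simp [hp]
  rw [e1, Fintype.card_piFinset, Nat.cast_prod]
  calc ∏ p, (((if p ∈ T then S p else Finset.univ).card : ℕ) : ℝ)
      ≤ ∏ p, ((if p ∈ T then ε else 1) * (Fintype.card α : ℝ)) := by
        apply Finset.prod_le_prod
        · intro p _; positivity
        · intro p _
          by_cases hp : p ∈ T
          · simpa [hp] using h p hp
          · simp [hp]
    _ = _ := by
        rw [Finset.prod_mul_distrib, Finset.prod_ite_mem, Finset.univ_inter]
        simp

def ltPairs (I : Finset ℕ) : Finset (ℕ × ℕ) := (I ×ˢ I).filter (fun p => p.1 < p.2)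

theorem card_ltPairs (I : Finset ℕ) : 2 * (ltPairs I).card + I.card = I.card * I.card := by
  have h1 : (ltPairs I).card = ((I ×ˢ I).filter (fun p => p.2 < p.1)).card := by
    apply Finset.card_bij (fun p _ => (p.2, p.1))
    · intro p hp
      simp only [ltPairs, Finset.mem_filter, Finset.mem_product] at hp ⊢
      exact ⟨⟨hp.1.2, hp.1.1⟩, hp.2⟩
    · rintro ⟨a, b⟩ _ ⟨c, d⟩ _ h
      simp only [Prod.mk.injEq] at h ⊢
      exact ⟨h.2, h.1⟩
    · rintro ⟨a, b⟩ hp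
      simp only [Finset.mem_filter, Finset.mem_product] at hp
      refine ⟨(b, a), ?_, rfl⟩
      simp only [ltPairs, Finset.mem_filter, Finset.mem_product]
      exact ⟨⟨hp.1.2, hp.1.1⟩, hp.2⟩
  have h2 : ((I ×ˢ I).filter (fun p => p.1 = p.2)).card = I.card := by
    have : (I ×ˢ I).filter (fun p => p.1 = p.2) = I.image (fun i => (i, i)) := by
      ext ⟨a, b⟩
      simp only [Finset.mem_filter, Finset.mem_product, Finset.mem_image, Prod.mk.injEq]
      constructor
      · rintro ⟨⟨ha, _⟩, rfl⟩; exact ⟨a, ha, rfl, rfl⟩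
      · rintro ⟨i, hi, rfl, rfl⟩; exact ⟨⟨hi, hi⟩, rfl⟩
    rw [this, Finset.card_image_of_injective]
    intro a b h
    simpa using h
  have h3 := Finset.card_filter_add_card_filter_not (s := I ×ˢ I) (fun p => p.1 < p.2)
  have h4 := Finset.card_filter_add_card_filter_not
    (s := (I ×ˢ I).filter (fun p => ¬ p.1 < p.2)) (fun p => p.1 = p.2)
  rw [Finset.filter_filter, Finset.filter_filter] at h4
  have e5 : (I ×ˢ I).filter (fun p => ¬ p.1 < p.2 ∧ p.1 = p.2) = (I ×ˢ I).filter (fun p => p.1 = p.2) := by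
    apply Finset.filter_congr; intro p _; omega
  have e6 : (I ×ˢ I).filter (fun p => ¬ p.1 < p.2 ∧ ¬ p.1 = p.2) = (I ×ˢ I).filter (fun p => p.2 < p.1) := by
    apply Finset.filter_congr; intro p _; omega
  rw [e5, e6, h2, ← h1] at h4
  rw [Finset.card_product] at h3
  change (ltPairs I).card + _ = _ at h3
  omega

theorem exists_G (D l Q K m : ℕ) (hQ : 0 < Q)
    (h1 : ((D : ℝ) + 1) ^ l * (1 - 1 / (Q : ℝ)) ^ (l * (l - 1) / 2) < 1 / 2)
    (h2 : (D + 1) * 2 ^ (K + 2) ≤ Q ^ m) :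
    ∃ R : ℕ → ℕ → Prop, (∀ i j, R i j → R j i) ∧ (∀ i, ¬ R i i) ∧
      (∀ I ⊆ Finset.range (D + 1), I.card = l → ∃ i ∈ I, ∃ j ∈ I, i < j ∧ R i j) ∧
      (∀ W : Finset ℕ, W ⊆ Finset.range (D + 1) → W.Nonempty → W.card ≤ K →
        ∃ i ∈ W, ∀ S ⊆ W, (∀ j ∈ S, R i j) → S.card ≤ 2 * m) := by
  classical
  obtain ⟨Q', rfl⟩ : ∃ Q', Q = Q' + 1 := ⟨Q - 1, by omega⟩
  let ι := Fin (D + 1) × Fin (D + 1)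
  let Ω := ι → Fin (Q' + 1)
  let c : ℕ × ℕ → ι := fun p => (Fin.ofNat (D + 1) p.1, Fin.ofNat (D + 1) p.2)
  have hcinj : ∀ I ⊆ Finset.range (D + 1), Set.InjOn c (ltPairs I) := by
    rintro I hI ⟨a, b⟩ hab ⟨a', b'⟩ hab' h
    simp only [ltPairs, Finset.coe_filter, Finset.mem_product, Set.mem_ofPred_eq] at hab hab'
    have q1 := Finset.mem_range.mp (hI hab.1.1)
    have q2 := Finset.mem_range.mp (hI hab.1.2)
    have q3 := Finset.mem_range.mp (hI hab'.1.1)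
    have q4 := Finset.mem_range.mp (hI hab'.1.2)
    have ha := congrArg (fun p : Fin (D + 1) × Fin (D + 1) => (p.1 : ℕ)) h
    have hb := congrArg (fun p : Fin (D + 1) × Fin (D + 1) => (p.2 : ℕ)) h
    simp only [c, Fin.val_ofNat, Nat.mod_eq_of_lt q1,
      Nat.mod_eq_of_lt q2, Nat.mod_eq_of_lt q3, Nat.mod_eq_of_lt q4] at ha hb
    rw [ha, hb]
  let tot : ℝ := (Fintype.card Ω : ℝ)
  have htot : 0 < tot := by
    simp only [tot]
    exact_mod_cast Fintype.card_pos
  let bad1 : Finset ℕ → Finset Ω := fun I =>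
    Finset.univ.filter (fun g : Ω => ∀ p ∈ (ltPairs I).image c, g p ∈ (Finset.univ.erase 0 : Finset (Fin (Q' + 1))))
  let bad2 : Finset (ℕ × ℕ) → Finset Ω := fun T =>
    Finset.univ.filter (fun g : Ω => ∀ p ∈ T.image c, g p ∈ ({0} : Finset (Fin (Q' + 1))))
  let B1 : Finset Ω := ((Finset.range (D + 1)).powersetCard l).biUnion bad1
  let F2 : Finset (Finset ℕ) := (Finset.range (D + 1)).powerset.filter (fun W => W.Nonempty ∧ W.card ≤ K)
  let B2 : Finset Ω := F2.biUnion (fun W => ((ltPairs W).powersetCard (m * W.card)).biUnion bad2)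
  have hB1 : (B1.card : ℝ) < 1 / 2 * tot := by
    have hb : ∀ I ∈ (Finset.range (D + 1)).powersetCard l, ((bad1 I).card : ℝ) ≤
        (1 - 1 / ((Q' + 1 : ℕ) : ℝ)) ^ (l * (l - 1) / 2) * tot := by
      intro I hI
      rw [Finset.mem_powersetCard] at hI
      have := card_pi_le ((ltPairs I).image c) (fun _ => (Finset.univ.erase 0 : Finset (Fin (Q' + 1))))
        (1 - 1 / ((Q' + 1 : ℕ) : ℝ)) (by
          intro p _
          rw [Finset.card_erase_of_mem (Finset.mem_univ _), Finset.card_univ, Fintype.card_fin]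
          push_cast
          simp
          field_simp
          linarith)
      rw [Finset.card_image_of_injOn (hcinj I hI.1)] at this
      have e : (ltPairs I).card = l * (l - 1) / 2 := by
        have := card_ltPairs I
        rw [hI.2] at this
        have e3 : l * (l - 1) = 2 * (ltPairs I).card := by
          cases l with
          | zero => omega
          | succ l => simp only [Nat.add_sub_cancel]; nlinarith
        omega
      rw [e] at this
      exact this
    calc (B1.card : ℝ) ≤ ∑ I ∈ (Finset.range (D + 1)).powersetCard l, ((bad1 I).card : ℝ) := by
          exact_mod_cast Finset.card_biUnion_le
      _ ≤ ∑ I ∈ (Finset.range (D + 1)).powersetCard l, 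
          (1 - 1 / ((Q' + 1 : ℕ) : ℝ)) ^ (l * (l - 1) / 2) * tot := Finset.sum_le_sum hb
      _ = ((D + 1).choose l : ℝ) * ((1 - 1 / ((Q' + 1 : ℕ) : ℝ)) ^ (l * (l - 1) / 2) * tot) := by
          rw [Finset.sum_const, Finset.card_powersetCard, Finset.card_range, nsmul_eq_mul]
      _ ≤ ((D : ℝ) + 1) ^ l * ((1 - 1 / ((Q' + 1 : ℕ) : ℝ)) ^ (l * (l - 1) / 2) * tot) := by
          apply mul_le_mul_of_nonneg_right
          · exact_mod_cast Nat.choose_le_pow _ _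
          · apply mul_nonneg _ htot.le
            apply pow_nonneg
            have : 1 / ((Q' + 1 : ℕ) : ℝ) ≤ 1 := by
              rw [div_le_one (by positivity)]; push_cast; linarith [Nat.cast_nonneg (α := ℝ) Q']
            linarith
      _ = (((D : ℝ) + 1) ^ l * (1 - 1 / ((Q' + 1 : ℕ) : ℝ)) ^ (l * (l - 1) / 2)) * tot := by ring
      _ < 1 / 2 * tot := mul_lt_mul_of_pos_right h1 htot
  let y : ℝ := 2 ^ K * (1 / ((Q' + 1 : ℕ) : ℝ)) ^ m
  have hy0 : 0 ≤ y := by positivity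
  have hyD : y * ((D : ℝ) + 1) ≤ 1 / 4 := by
    have h2' : ((D : ℝ) + 1) * 2 ^ (K + 2) ≤ ((Q' + 1 : ℕ) : ℝ) ^ m := by exact_mod_cast h2
    simp only [y]
    rw [one_div, inv_pow]
    have hp : (0 : ℝ) < ((Q' + 1 : ℕ) : ℝ) ^ m := by positivity
    rw [← div_eq_mul_inv, div_mul_eq_mul_div, div_le_iff₀ hp]
    rw [pow_add] at h2'
    linarith
  have hB2 : (B2.card : ℝ) < 1 / 2 * tot := by
    have hb : ∀ W ∈ F2, ((((ltPairs W).powersetCard (m * W.card)).biUnion bad2).card : ℝ) ≤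
        y ^ W.card * tot := by
      intro W hW
      simp only [F2, Finset.mem_filter, Finset.mem_powerset] at hW
      have hb2 : ∀ T ∈ (ltPairs W).powersetCard (m * W.card), ((bad2 T).card : ℝ) ≤
          (1 / ((Q' + 1 : ℕ) : ℝ)) ^ (m * W.card) * tot := by
        intro T hT
        rw [Finset.mem_powersetCard] at hT
        have := card_pi_le (T.image c) (fun _ => ({0} : Finset (Fin (Q' + 1))))
          (1 / ((Q' + 1 : ℕ) : ℝ)) (by
            intro p _
            rw [Finset.card_singleton, Fintype.card_fin, one_div, inv_mul_cancel₀ (by positivity)]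
            simp)
        rw [Finset.card_image_of_injOn ((hcinj W hW.1).mono (by exact_mod_cast hT.1)), hT.2] at this
        exact this
      calc ((((ltPairs W).powersetCard (m * W.card)).biUnion bad2).card : ℝ)
          ≤ ∑ T ∈ (ltPairs W).powersetCard (m * W.card), ((bad2 T).card : ℝ) := by
            exact_mod_cast Finset.card_biUnion_le
        _ ≤ ∑ T ∈ (ltPairs W).powersetCard (m * W.card), 
            (1 / ((Q' + 1 : ℕ) : ℝ)) ^ (m * W.card) * tot := Finset.sum_le_sum hb2
        _ = (((ltPairs W).powersetCard (m * W.card)).card : ℝ) *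
            ((1 / ((Q' + 1 : ℕ) : ℝ)) ^ (m * W.card) * tot) := by
            rw [Finset.sum_const, nsmul_eq_mul]
        _ ≤ (2 ^ K) ^ W.card * ((1 / ((Q' + 1 : ℕ) : ℝ)) ^ (m * W.card) * tot) := by
            apply mul_le_mul_of_nonneg_right _ (by positivity)
            have e1 : ((ltPairs W).powersetCard (m * W.card)).card ≤ 2 ^ (ltPairs W).card := by
              rw [← Finset.card_powerset]
              exact Finset.card_le_card (fun T hT =>
                Finset.mem_powerset.mpr (Finset.mem_powersetCard.mp hT).1)
            have e2 : (ltPairs W).card ≤ K * W.card := by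
              have := card_ltPairs W
              nlinarith [hW.2.2]
            have e3 : ((ltPairs W).powersetCard (m * W.card)).card ≤ (2 ^ K) ^ W.card := by
              rw [← pow_mul]
              exact e1.trans (Nat.pow_le_pow_right (by norm_num) e2)
            exact_mod_cast e3
        _ = y ^ W.card * tot := by
            simp only [y]; rw [mul_pow, ← pow_mul, ← pow_mul]; ring
    have hsum : ∑ W ∈ F2, y ^ W.card ≤ (y + 1) ^ (D + 1) - 1 := by
      have := Finset.sum_pow_mul_eq_add_pow y 1 (Finset.range (D + 1))
      simp only [one_pow, mul_one, Finset.card_range] at this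
      rw [← this, le_sub_iff_add_le, ← Finset.add_sum_erase _ _ (Finset.empty_mem_powerset _)]
      rw [Finset.card_empty, pow_zero, add_comm]
      gcongr
      intro W hW
      simp only [F2, Finset.mem_filter] at hW
      exact Finset.mem_erase.mpr ⟨hW.2.1.ne_empty, hW.1⟩
    have hexp : (y + 1) ^ (D + 1) - 1 < 1 / 2 := by
      have e1 : (y + 1) ^ (D + 1) ≤ Real.exp (1 / 4) := by
        calc (y + 1) ^ (D + 1) ≤ (Real.exp y) ^ (D + 1) := by
              gcongr; exact Real.add_one_le_exp y
          _ = Real.exp (y * ((D : ℝ) + 1)) := by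
              rw [← Real.exp_nat_mul]; push_cast; ring_nf
          _ ≤ _ := Real.exp_le_exp.mpr hyD
      have e2 : Real.exp (1 / 4) < 3 / 2 := by
        have h3 : Real.exp (1 / 4) ^ 4 = Real.exp 1 := by
          rw [← Real.exp_nat_mul]; norm_num
        have h4 := Real.exp_one_lt_d9
        by_contra hcon
        have : (3 / 2 : ℝ) ^ 4 ≤ Real.exp (1 / 4) ^ 4 := by
          gcongr; exact not_lt.mp hcon
        rw [h3] at this
        norm_num at this
        linarith
      linarith
    calc (B2.card : ℝ) ≤ ∑ W ∈ F2, ((((ltPairs W).powersetCard (m * W.card)).biUnion bad2).card : ℝ) := by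
          exact_mod_cast Finset.card_biUnion_le
      _ ≤ ∑ W ∈ F2, y ^ W.card * tot := Finset.sum_le_sum hb
      _ = (∑ W ∈ F2, y ^ W.card) * tot := by rw [Finset.sum_mul]
      _ < 1 / 2 * tot := mul_lt_mul_of_pos_right (lt_of_le_of_lt hsum hexp) htot
  obtain ⟨g, hg⟩ : ∃ g : Ω, g ∉ B1 ∪ B2 := by
    by_contra hcon
    push Not at hcon
    have e : (Finset.univ : Finset Ω).card ≤ (B1 ∪ B2).card := Finset.card_le_card (fun g _ => hcon g)
    rw [Finset.card_univ] at e
    have e2 := e.trans (Finset.card_union_le _ _)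
    have e3 : tot ≤ B1.card + B2.card := by simp only [tot]; exact_mod_cast e2
    linarith
  rw [Finset.mem_union, not_or] at hg
  obtain ⟨hg1, hg2⟩ := hg
  let R : ℕ → ℕ → Prop := fun i j => (i < j ∧ g (c (i, j)) = 0) ∨ (j < i ∧ g (c (j, i)) = 0)
  refine ⟨R, ?_, ?_, ?_, ?_⟩
  · intro i j h; exact h.symm
  · intro i h; rcases h with h | h <;> exact lt_irrefl _ h.1
  · intro I hI hIl
    by_contra hcon
    push Not at hcon
    apply hg1
    simp only [B1, Finset.mem_biUnion, Finset.mem_powersetCard]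
    refine ⟨I, ⟨hI, hIl⟩, ?_⟩
    simp only [bad1, Finset.mem_filter, Finset.mem_univ, true_and, Finset.mem_image, Finset.mem_erase, and_true]
    rintro _ ⟨⟨i, j⟩, hij, rfl⟩ h0
    simp only [ltPairs, Finset.mem_filter, Finset.mem_product] at hij
    exact hcon i hij.1.1 j hij.1.2 hij.2 (Or.inl ⟨hij.2, h0⟩)
  · intro W hW hWn hWK
    by_contra hcon
    push Not at hcon
    have hdeg : ∀ i ∈ W, 2 * m ≤ (W.filter (fun j => R i j)).card := by
      intro i hi
      obtain ⟨S, hS, hSR, hSc⟩ := hcon i hi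
      exact hSc.le.trans (Finset.card_le_card (fun j hj => Finset.mem_filter.mpr ⟨hS hj, hSR j hj⟩))
    let X := (ltPairs W).filter (fun p => g (c p) = 0)
    have hX : m * W.card ≤ X.card := by
      have s1 : W.card * (2 * m) ≤ ∑ i ∈ W, (W.filter (fun j => R i j)).card := by
        rw [← smul_eq_mul]; exact Finset.card_nsmul_le_sum _ _ _ hdeg
      have s2 : ∑ i ∈ W, (W.filter (fun j => R i j)).card = ((W ×ˢ W).filter (fun p => R p.1 p.2)).card := by
        rw [Finset.card_filter, Finset.sum_product]
        apply Finset.sum_congr rfl; intro i _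
        rw [Finset.card_filter]
      have s3 : (W ×ˢ W).filter (fun p => R p.1 p.2) ⊆ X ∪ X.image Prod.swap := by
        rintro ⟨i, j⟩ hp
        simp only [Finset.mem_filter, Finset.mem_product] at hp
        rw [Finset.mem_union]
        rcases hp.2 with h | h
        · left
          simp only [X, ltPairs, Finset.mem_filter, Finset.mem_product]
          exact ⟨⟨hp.1, h.1⟩, h.2⟩
        · right
          refine Finset.mem_image.mpr ⟨(j, i), ?_, rfl⟩
          simp only [X, ltPairs, Finset.mem_filter, Finset.mem_product]
          exact ⟨⟨⟨hp.1.2, hp.1.1⟩, h.1⟩, h.2⟩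
      have s4 := (Finset.card_le_card s3).trans (Finset.card_union_le _ _)
      have s5 : (X.image Prod.swap).card ≤ X.card := Finset.card_image_le
      nlinarith
    obtain ⟨T, hT, hTc⟩ := Finset.exists_subset_card_eq hX
    apply hg2
    simp only [B2, Finset.mem_biUnion]
    refine ⟨W, ?_, T, ?_, ?_⟩
    · simp only [F2, Finset.mem_filter, Finset.mem_powerset]
      exact ⟨hW, hWn, hWK⟩
    · rw [Finset.mem_powersetCard]
      exact ⟨hT.trans (Finset.filter_subset _ _), hTc⟩
    · simp only [bad2, Finset.mem_filter, Finset.mem_univ, true_and, Finset.mem_image, Finset.mem_singleton]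
      rintro _ ⟨p, hp, rfl⟩
      exact (Finset.mem_filter.mp (hT hp)).2


theorem degen_weight (R : ℕ → ℕ → Prop) [DecidableRel R] (hsymm : ∀ i j, R i j → R j i)
    (w : ℕ → ℕ) (b d : ℕ) :
    ∀ W : Finset ℕ, (∀ i ∈ W, w i ≤ b) →
      (∀ S ⊆ W, S.Nonempty → ∃ i ∈ S, (S.filter (fun j => R i j)).card ≤ d) →
      ∑ i ∈ W, ∑ j ∈ W, (if R i j then w i * w j else 0) ≤ 2 * d * b * ∑ i ∈ W, w i := by
  intro W
  induction W using Finset.strongInduction with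
  | H W ih =>
    intro hb hd
    rcases W.eq_empty_or_nonempty with rfl | hne
    · simp
    obtain ⟨i, hi, hic⟩ := hd W (Finset.Subset.refl _) hne
    have h1 := ih (W.erase i) (Finset.erase_ssubset hi)
      (fun j hj => hb j (Finset.mem_of_mem_erase hj))
      (fun S hS => hd S (hS.trans (Finset.erase_subset _ _)))
    have hrow : ∑ j ∈ W, (if R i j then w i * w j else 0) ≤ w i * (d * b) := by
      rw [← Finset.sum_filter]
      calc ∑ j ∈ W.filter (fun j => R i j), w i * w j
          ≤ ∑ j ∈ W.filter (fun j => R i j), w i * b := by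
            apply Finset.sum_le_sum
            intro j hj
            exact Nat.mul_le_mul_left _ (hb j (Finset.mem_filter.mp hj).1)
        _ = (W.filter (fun j => R i j)).card * (w i * b) := by simp
        _ ≤ d * (w i * b) := Nat.mul_le_mul_right _ hic
        _ = w i * (d * b) := by ring
    have hcol : ∑ k ∈ W.erase i, (if R k i then w k * w i else 0) ≤ w i * (d * b) := by
      refine le_trans ?_ hrow
      refine le_trans (Finset.sum_le_sum_of_subset (Finset.erase_subset i W)) ?_
      apply Finset.sum_le_sum
      intro k _
      by_cases h : R k i
      · rw [if_pos h, if_pos (hsymm _ _ h), mul_comm]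
      · rw [if_neg h]; exact Nat.zero_le _
    rw [← Finset.add_sum_erase W _ hi, ← Finset.add_sum_erase W w hi]
    have hsplit : ∑ k ∈ W.erase i, ∑ j ∈ W, (if R k j then w k * w j else 0)
        = ∑ k ∈ W.erase i, (if R k i then w k * w i else 0)
          + ∑ k ∈ W.erase i, ∑ j ∈ W.erase i, (if R k j then w k * w j else 0) := by
      rw [← Finset.sum_add_distrib]
      apply Finset.sum_congr rfl
      intro k _
      rw [← Finset.add_sum_erase W _ hi]
    rw [hsplit]
    calc _ ≤ w i * (d * b) + (w i * (d * b) + 2 * d * b * ∑ i ∈ W.erase i, w i) := by gcongr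
      _ = _ := by ring

theorem cluster_exists {P : Type*} [Fintype P] [DecidableEq P] (q D : ℕ) (hq : 2 ≤ q)
    (hP : Fintype.card P = q ^ 2) (ψ : P → ℕ) (hinj : Function.Injective ψ)
    (hψ : ∀ p, ψ p < 2 ^ D) :
    ∃ s : ℕ, ∃ c : P,
      q ^ 2 < 4 * (Finset.univ.filter (fun v => hh (ψ v) (ψ c) ≤ s)).card ∧
      2 * (Finset.univ.filter (fun v => hh (ψ v) (ψ c) ≤ s)).card ≤ q ^ 2 := by
  classical
  have hne : Nonempty P := by
    rw [← Fintype.card_pos_iff, hP]; positivity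
  have hex : ∃ t : ℕ, ∃ c : P,
      q ^ 2 < 2 * (Finset.univ.filter (fun v => hh (ψ v) (ψ c) ≤ t)).card := by
    refine ⟨D, hne.some, ?_⟩
    rw [Finset.filter_true_of_mem (fun v _ => hh_le_of_lt (hψ v) (hψ _)), Finset.card_univ, hP]
    have : 0 < q ^ 2 := by positivity
    omega
  obtain ⟨t, ⟨c0, hc0⟩, hmin⟩ : ∃ t : ℕ, (∃ c : P,
      q ^ 2 < 2 * (Finset.univ.filter (fun v => hh (ψ v) (ψ c) ≤ t)).card) ∧
      ∀ s < t, ¬ ∃ c : P,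
      q ^ 2 < 2 * (Finset.univ.filter (fun v => hh (ψ v) (ψ c) ≤ s)).card :=
    ⟨Nat.find hex, Nat.find_spec hex, fun s hs => Nat.find_min hex hs⟩
  cases t with
  | zero =>
    exfalso
    have : (Finset.univ.filter (fun v => hh (ψ v) (ψ c0) ≤ 0)).card ≤ 1 := by
      rw [Finset.card_le_one]
      intro a ha b hb
      simp only [Finset.mem_filter, Finset.mem_univ, true_and, Nat.le_zero] at ha hb
      exact hinj ((hh_eq_zero ha).trans (hh_eq_zero hb).symm)
    nlinarith
  | succ s =>
    let r := ψ c0 / 2 ^ (s + 1)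
    have hsub : Finset.univ.filter (fun v => hh (ψ v) (ψ c0) ≤ s + 1) ⊆
        Finset.univ.filter (fun v => ψ v / 2 ^ s = 2 * r) ∪
        Finset.univ.filter (fun v => ψ v / 2 ^ s = 2 * r + 1) := by
      intro v hv
      simp only [Finset.mem_filter, Finset.mem_univ, true_and, hh_le_iff] at hv
      have hv' : ψ v / 2 ^ s / 2 = r := by
        rw [Nat.div_div_eq_div_mul, ← pow_succ]; exact hv
      simp only [Finset.mem_union, Finset.mem_filter, Finset.mem_univ, true_and]
      omega
    have hcard := (Finset.card_le_card hsub).trans (Finset.card_union_le _ _)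
    have key : ∀ m : ℕ, q ^ 2 < 4 * (Finset.univ.filter (fun v => ψ v / 2 ^ s = m)).card →
        ∃ s : ℕ, ∃ c : P,
      q ^ 2 < 4 * (Finset.univ.filter (fun v => hh (ψ v) (ψ c) ≤ s)).card ∧
      2 * (Finset.univ.filter (fun v => hh (ψ v) (ψ c) ≤ s)).card ≤ q ^ 2 := by
      intro m hm
      obtain ⟨c, hc⟩ : (Finset.univ.filter (fun v => ψ v / 2 ^ s = m)).Nonempty :=
        Finset.card_pos.mp (by omega)
      simp only [Finset.mem_filter, Finset.mem_univ, true_and] at hc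
      have heq : Finset.univ.filter (fun v => hh (ψ v) (ψ c) ≤ s) =
          Finset.univ.filter (fun v => ψ v / 2 ^ s = m) := by
        ext v
        simp only [Finset.mem_filter, Finset.mem_univ, true_and, hh_le_iff, hc]
      refine ⟨s, c, by rwa [heq], ?_⟩
      by_contra hcon
      exact hmin s (Nat.lt_succ_self s) ⟨c, by omega⟩
    by_cases h0 : q ^ 2 < 4 * (Finset.univ.filter (fun v => ψ v / 2 ^ s = 2 * r)).card
    · exact key _ h0
    · exact key (2 * r + 1) (by omega)

theorem no_red_copy {P : Type*} [Fintype P] [DecidableEq P] (q K C d D : ℕ) (hq : 2 ≤ q)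
    (hK : 0 < K) (hKq : 4 * K ≤ q)
    (hP : Fintype.card P = q ^ 2) (T : P → P → P → Prop)
    (hs1 : ∀ a b c, T a b c → T b a c) (hs2 : ∀ a b c, T a b c → T a c b)
    (hne : ∀ a b c, T a b c → a ≠ b)
    (hT : ∀ A B : Finset P, Disjoint A B → q ^ 2 ≤ 8 * A.card → K * q ≤ B.card →
      ∃ X : Finset (P × P), X ⊆ B ×ˢ B ∧ (∀ p ∈ X, ∃ z ∈ A, T p.1 p.2 z) ∧
        B.card ^ 2 ≤ C * X.card)
    (ψ : P → ℕ) (hinj : Function.Injective ψ) (hψ : ∀ p, ψ p < 2 ^ D)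
    (R : ℕ → ℕ → Prop) (hsymm : ∀ i j, R i j → R j i) (hirr : ∀ i, ¬ R i i)
    (hdeg : ∀ W : Finset ℕ, W ⊆ Finset.range (D + 1) → W.Nonempty → W.card ≤ q ^ 2 →
      ∃ i ∈ W, ∀ S ⊆ W, (∀ j ∈ S, R i j) → S.card ≤ d)
    (hred : ∀ a b c, T a b c → ψ a < ψ b → ψ b < ψ c →
      hh (ψ a) (ψ b) < hh (ψ b) (ψ c) ∧ R (hh (ψ a) (ψ b)) (hh (ψ b) (ψ c))) :
    q ≤ 8 * C * K * d := by
  classical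
  obtain ⟨s, c, hC4, hC2⟩ := cluster_exists q D hq hP ψ hinj hψ
  set Cl := Finset.univ.filter (fun v => hh (ψ v) (ψ c) ≤ s) with hCl
  have memC : ∀ v, v ∈ Cl ↔ hh (ψ v) (ψ c) ≤ s := by intro v; simp [hCl]
  clear_value Cl
  obtain ⟨U, memU⟩ : ∃ U : Finset P, ∀ v, v ∈ U ↔ (v ∉ Cl ∧ ψ c < ψ v) :=
    ⟨Finset.univ.filter (fun v => v ∉ Cl ∧ ψ c < ψ v), by intro v; simp⟩
  obtain ⟨Dp, memD⟩ : ∃ U : Finset P, ∀ v, v ∈ U ↔ (v ∉ Cl ∧ ψ v < ψ c) :=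
    ⟨Finset.univ.filter (fun v => v ∉ Cl ∧ ψ v < ψ c), by intro v; simp⟩
  have hcC : c ∈ Cl := by rw [memC, hh_self]; omega
  -- distances from outside
  have hout : ∀ v, v ∉ Cl → ∀ x ∈ Cl, hh (ψ v) (ψ x) = hh (ψ v) (ψ c) := by
    intro v hv x hx
    rw [memC] at hv hx
    have h1 := hh_ultra (ψ v) (ψ c) (ψ x)
    have h2 := hh_ultra (ψ v) (ψ x) (ψ c)
    rw [hh_comm (ψ c) (ψ x)] at h1
    rcases le_max_iff.mp h1 with h | h <;> rcases le_max_iff.mp h2 with h' | h' <;> omega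
  have hin : ∀ x ∈ Cl, ∀ y ∈ Cl, hh (ψ x) (ψ y) ≤ s := by
    intro x hx y hy
    rw [memC] at hx hy
    have h1 := hh_ultra (ψ x) (ψ c) (ψ y)
    rw [hh_comm (ψ c) (ψ y)] at h1
    rcases le_max_iff.mp h1 with h | h <;> omega
  have hUlt : ∀ v ∈ U, ∀ x ∈ Cl, ψ x < ψ v := by
    intro v hv x hx
    rw [memU] at hv
    by_contra hcon
    have h1 := hh_mono_left hv.2.le (not_lt.mp hcon)
    have h2 := hin c hcC x hx
    have h3 := hv.1
    rw [memC, hh_comm] at h3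
    omega
  have hDlt : ∀ v ∈ Dp, ∀ x ∈ Cl, ψ v < ψ x := by
    intro v hv x hx
    rw [memD] at hv
    by_contra hcon
    have h1 := hh_mono_right (not_lt.mp hcon) hv.2.le
    have h2 := hin x hx c hcC
    have h3 := hv.1
    rw [memC] at h3
    omega
  have hq0 : 0 < q := by omega
  have hKC : K * q ≤ Cl.card := by nlinarith
  have h8C : q ^ 2 ≤ 8 * Cl.card := by omega
  -- no edges Dp C C
  have hnoD : ∀ a ∈ Dp, ∀ x ∈ Cl, ∀ y ∈ Cl, ψ x < ψ y → ¬ T a x y := by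
    intro a ha x hx y hy hxy hTT
    have h1 := (hred a x y hTT (hDlt a ha x hx) hxy).1
    have h2 := hin x hx y hy
    have h3 := hout a ((memD a).mp ha).1 x hx
    have h4 := ((memD a).mp ha).1
    rw [memC] at h4
    omega
  have hDcard : 8 * Dp.card < q ^ 2 := by
    by_contra hcon
    obtain ⟨X, hX, hXT, hXc⟩ := hT Dp Cl (by
      rw [Finset.disjoint_left]; intro v hv; exact ((memD v).mp hv).1) (not_lt.mp hcon) hKC
    have hXe : X = ∅ := by
      rw [Finset.eq_empty_iff_forall_notMem]
      intro p hp
      obtain ⟨z, hz, hzT⟩ := hXT p hp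
      have hp' := Finset.mem_product.mp (hX hp)
      have hnp : ψ p.1 ≠ ψ p.2 := fun h => hne _ _ _ hzT (hinj h)
      rcases lt_or_gt_of_ne hnp with h | h
      · exact hnoD z hz p.1 hp'.1 p.2 hp'.2 h (hs1 _ _ _ (hs2 _ _ _ hzT))
      · exact hnoD z hz p.2 hp'.2 p.1 hp'.1 h (hs2 _ _ _ (hs1 _ _ _ (hs2 _ _ _ hzT)))
    rw [hXe, Finset.card_empty, mul_zero] at hXc
    have : 0 < Cl.card ^ 2 := by
      have : 0 < Cl.card := by nlinarith
      positivity
    omega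
  have hpart : q ^ 2 ≤ Cl.card + Dp.card + U.card := by
    rw [← hP, ← Finset.card_univ]
    calc (Finset.univ : Finset P).card ≤ (Cl ∪ Dp ∪ U).card := by
          apply Finset.card_le_card
          intro v _
          by_cases hv : v ∈ Cl
          · simp [hv]
          · have hnv : ψ v ≠ ψ c := fun h => hv (hinj h ▸ hcC)
            rcases lt_or_gt_of_ne hnv with h | h
            · have : v ∈ Dp := (memD v).mpr ⟨hv, h⟩
              simp [this]
            · have : v ∈ U := (memU v).mpr ⟨hv, h⟩
              simp [this]
      _ ≤ _ := (Finset.card_union_le _ _).trans (Nat.add_le_add_right (Finset.card_union_le _ _) _)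
  have hU4 : q ^ 2 ≤ 4 * U.card := by omega
  have hKU : K * q ≤ U.card := by nlinarith
  have hdisj : ∀ V ⊆ U, Disjoint Cl V := by
    intro V hV
    rw [Finset.disjoint_left]; intro v hv hv'
    exact ((memU v).mp (hV hv')).1 hv
  let lev : P → ℕ := fun v => hh (ψ v) (ψ c)
  -- edges x < v < w
  have hedge : ∀ x ∈ Cl, ∀ v ∈ U, ∀ w ∈ U, ψ v < ψ w → T x v w → lev v < lev w ∧ R (lev v) (lev w) := by
    intro x hx v hv w hw hvw hTT
    have hxv := hUlt v hv x hx
    obtain ⟨h1, h2⟩ := hred x v w hTT hxv hvw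
    have e1 : hh (ψ x) (ψ v) = lev v := by rw [hh_comm, hout v ((memU v).mp hv).1 x hx]
    have e2 : hh (ψ x) (ψ w) = lev w := by rw [hh_comm, hout w ((memU w).mp hw).1 x hx]
    have e3 := hh_max hxv.le hvw.le
    rw [max_eq_right h1.le, e2] at e3
    rw [e1, ← e3] at h1 h2
    exact ⟨h1, h2⟩
  have hedge' : ∀ x ∈ Cl, ∀ v ∈ U, ∀ w ∈ U, T v w x → R (lev v) (lev w) := by
    intro x hx v hv w hw hTT
    have hnp : ψ v ≠ ψ w := fun h => hne _ _ _ hTT (hinj h)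
    rcases lt_or_gt_of_ne hnp with h | h
    · exact (hedge x hx v hv w hw h (hs1 _ _ _ (hs2 _ _ _ hTT))).2
    · exact hsymm _ _ (hedge x hx w hw v hv h (hs1 _ _ _ (hs2 _ _ _ (hs1 _ _ _ hTT)))).2
  let w : ℕ → ℕ := fun i => (U.filter (fun v => lev v = i)).card
  have hw : ∀ i, w i ≤ K * q := by
    intro i
    by_contra hcon
    obtain ⟨X, hX, hXT, hXc⟩ := hT Cl (U.filter (fun v => lev v = i))
      (hdisj _ (Finset.filter_subset _ _)) h8C (not_le.mp hcon).le
    have hXe : X = ∅ := by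
      rw [Finset.eq_empty_iff_forall_notMem]
      intro p hp
      obtain ⟨z, hz, hzT⟩ := hXT p hp
      have hp' := Finset.mem_product.mp (hX hp)
      rw [Finset.mem_filter, Finset.mem_filter] at hp'
      have := hedge' z hz p.1 hp'.1.1 p.2 hp'.2.1 hzT
      rw [hp'.1.2, hp'.2.2] at this
      exact hirr _ this
    rw [hXe, Finset.card_empty, mul_zero] at hXc
    have h0 : 0 < (U.filter (fun v => lev v = i)).card := lt_of_le_of_lt (Nat.zero_le _) (not_le.mp hcon)
    have : 0 < (U.filter (fun v => lev v = i)).card ^ 2 := by positivity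
    omega
  let W := U.image lev
  have hWr : W ⊆ Finset.range (D + 1) := by
    intro i hi
    obtain ⟨v, hv, rfl⟩ := Finset.mem_image.mp hi
    have := hh_le_of_lt (hψ v) (hψ c)
    simp only [Finset.mem_range, lev]; omega
  have hWc : W.card ≤ q ^ 2 := by
    rw [← hP, ← Finset.card_univ]
    exact Finset.card_image_le.trans (Finset.card_le_card (Finset.subset_univ _))
  have hdw := degen_weight R hsymm w (K * q) d W (fun i _ => hw i) (fun S hS hSn => by
    obtain ⟨i, hi, h⟩ := hdeg S (hS.trans hWr) hSn ((Finset.card_le_card hS).trans hWc)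
    exact ⟨i, hi, h _ (Finset.filter_subset _ _) (fun j hj => (Finset.mem_filter.mp hj).2)⟩)
  have hsumw : ∑ i ∈ W, w i = U.card :=
    (Finset.card_eq_sum_card_fiberwise (fun v hv => Finset.mem_image_of_mem lev hv)).symm
  obtain ⟨X, hX, hXT, hXc⟩ := hT Cl U (hdisj U (Finset.Subset.refl _)) h8C hKU
  have hXle : X.card ≤ ∑ i ∈ W, ∑ j ∈ W, (if R i j then w i * w j else 0) := by
    calc X.card = ∑ p ∈ W ×ˢ W, (X.filter (fun x => (lev x.1, lev x.2) = p)).card := by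
          apply Finset.card_eq_sum_card_fiberwise
          intro x hx
          have hp' := Finset.mem_product.mp (hX hx)
          exact Finset.mem_product.mpr ⟨Finset.mem_image_of_mem lev hp'.1, Finset.mem_image_of_mem lev hp'.2⟩
      _ = ∑ i ∈ W, ∑ j ∈ W, (X.filter (fun x => (lev x.1, lev x.2) = (i, j))).card :=
          Finset.sum_product _ _ _
      _ ≤ _ := by
          apply Finset.sum_le_sum; intro i _
          apply Finset.sum_le_sum; intro j _
          by_cases hR : R i j
          · rw [if_pos hR]
            simp only [w]
            rw [← Finset.card_product]
            apply Finset.card_le_card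
            intro x hx
            rw [Finset.mem_filter, Prod.mk.injEq] at hx
            have hp' := Finset.mem_product.mp (hX hx.1)
            simp only [Finset.mem_product, Finset.mem_filter]
            exact ⟨⟨hp'.1, hx.2.1⟩, hp'.2, hx.2.2⟩
          · rw [if_neg hR, Nat.le_zero, Finset.card_eq_zero, Finset.eq_empty_iff_forall_notMem]
            intro x hx
            rw [Finset.mem_filter, Prod.mk.injEq] at hx
            have hp' := Finset.mem_product.mp (hX hx.1)
            obtain ⟨z, hz, hzT⟩ := hXT x hx.1
            have := hedge' z hz x.1 hp'.1 x.2 hp'.2 hzT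
            rw [hx.2.1, hx.2.2] at this
            exact hR this
  rw [hsumw] at hdw
  have hfin : U.card ^ 2 ≤ C * (2 * d * (K * q) * U.card) :=
    hXc.trans (Nat.mul_le_mul_left _ (hXle.trans hdw))
  have hU0 : 0 < U.card := by nlinarith
  have hfin2 : U.card ≤ C * (2 * d * (K * q)) := by
    have : U.card * U.card ≤ (C * (2 * d * (K * q))) * U.card := by nlinarith
    exact Nat.le_of_mul_le_mul_right this hU0
  have : q * q ≤ (8 * C * K * d) * q := by nlinarith
  exact Nat.le_of_mul_le_mul_right this hq0


theorem swap_upper {α : Type*} [Fintype α] [DecidableEq α] (S : Finset (Equiv.Perm α)) (w : α)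
    (T : Finset α) (val : Equiv.Perm α → α)
    (hS : ∀ π ∈ S, ∀ v ∈ T, π * Equiv.swap w v ∈ S)
    (hval : ∀ π ∈ S, ∀ v ∈ T, val (π * Equiv.swap w v) = val π) :
    (S.filter (fun π => π w = val π)).card * T.card ≤ S.card := by
  rw [← Finset.card_product]
  apply Finset.card_le_card_of_injOn (fun p : Equiv.Perm α × α => p.1 * Equiv.swap w p.2)
  · rintro ⟨π, v⟩ h
    simp only [Finset.coe_product, Set.mem_prod, Finset.mem_coe, Finset.mem_filter] at h
    exact hS π h.1.1 v h.2
  · rintro ⟨π, v⟩ h ⟨π', v'⟩ h' he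
    simp only [Finset.coe_product, Set.mem_prod, Finset.mem_coe, Finset.mem_filter] at h h' he
    have e1 : (π * Equiv.swap w v) v = val (π * Equiv.swap w v) := by
      rw [hval π h.1.1 v h.2, Equiv.Perm.mul_apply, Equiv.swap_apply_right, h.1.2]
    have e2 : (π' * Equiv.swap w v') v' = val (π' * Equiv.swap w v') := by
      rw [hval π' h'.1.1 v' h'.2, Equiv.Perm.mul_apply, Equiv.swap_apply_right, h'.1.2]
    have hv : v = v' := by
      apply (π * Equiv.swap w v).injective
      rw [e1, he, e2]
    subst hv
    have := mul_right_cancel he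
    rw [this]

theorem swap_fix {α : Type*} [DecidableEq α] (π : Equiv.Perm α) {w v x : α} (h1 : x ≠ w)
    (h2 : x ≠ v) : (π * Equiv.swap w v) x = π x := by
  rw [Equiv.Perm.mul_apply, Equiv.swap_apply_of_ne_of_ne h1 h2]

theorem perline_num (N M Q b : ℝ) (hNpos : 0 < N) (hQb : (2 : ℝ) ^ 30 ≤ Q) (hMb : Q * 2 ^ 20 ≤ M)
    (fin : b * (M / Q) ^ 2 / 4 ≤
      M * (M * ((N / (Q - 2)) / (Q - 5)) + 2 * (N / (Q - 2))) -
        2 * (M / Q) * (M * (N * (Q - 3) / ((Q - 1) * (Q - 2)))) + (M / Q) ^ 2 * N) :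
    b ≤ 1 / 2 ^ 16 * N := by
  have hQ2 : 0 < Q - 2 := by norm_num at hQb ⊢; linarith
  have hQ5 : 0 < Q - 5 := by norm_num at hQb ⊢; linarith
  have hQ1 : 0 < Q - 1 := by norm_num at hQb ⊢; linarith
  have hQ0 : 0 < Q := by linarith
  have hMpos : 0 < M := by nlinarith
  have fin2 : M * (M * ((N / (Q - 2)) / (Q - 5)) + 2 * (N / (Q - 2))) -
      2 * (M / Q) * (M * (N * (Q - 3) / ((Q - 1) * (Q - 2)))) + (M / Q) ^ 2 * N =
      (M / Q) ^ 2 * N * (Q ^ 2 / ((Q - 2) * (Q - 5)) + 2 * (Q / M) * (Q / (Q - 2)) -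
        2 * (Q * (Q - 3) / ((Q - 1) * (Q - 2))) + 1) := by
    field_simp
  have n1 : Q ^ 2 / ((Q - 2) * (Q - 5)) ≤ 1 + 8 / Q := by
    rw [div_le_iff₀ (by positivity)]
    have : (1 + 8 / Q) * ((Q - 2) * (Q - 5)) = Q ^ 2 + Q - 46 + 80 / Q := by field_simp; ring
    rw [this]
    have : 0 < 80 / Q := by positivity
    norm_num at hQb
    linarith
  have n2 : 1 - 1 / Q ≤ Q * (Q - 3) / ((Q - 1) * (Q - 2)) := by
    rw [le_div_iff₀ (by positivity)]
    have : (1 - 1 / Q) * ((Q - 1) * (Q - 2)) = Q ^ 2 - 4 * Q + 5 - 2 / Q := by field_simp; ring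
    rw [this]
    have : 0 < 2 / Q := by positivity
    norm_num at hQb
    nlinarith
  have n3 : Q / M ≤ 1 / 2 ^ 20 := by
    rw [div_le_div_iff₀ hMpos (by positivity)]; linarith
  have n4 : Q / (Q - 2) ≤ 5 / 4 := by
    rw [div_le_iff₀ hQ2]; norm_num at hQb; linarith
  have n5 : (Q / M) * (Q / (Q - 2)) ≤ 1 / 2 ^ 20 * (5 / 4) :=
    mul_le_mul n3 n4 (by positivity) (by positivity)
  have n6 : 1 / Q ≤ 1 / 2 ^ 30 := one_div_le_one_div_of_le (by positivity) hQb
  have n7 : 8 / Q = 8 * (1 / Q) := by ring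
  have n8 : Q ^ 2 / ((Q - 2) * (Q - 5)) + 2 * (Q / M) * (Q / (Q - 2)) -
        2 * (Q * (Q - 3) / ((Q - 1) * (Q - 2))) + 1 ≤ 1 / 2 ^ 18 := by
    norm_num at n5 n6 ⊢
    rw [n7] at n1
    norm_num at n1 n2
    linarith
  rw [fin2] at fin
  have hpos : 0 < (M / Q) ^ 2 := by positivity
  have f3 : b * (M / Q) ^ 2 / 4 ≤ (M / Q) ^ 2 * N * (1 / 2 ^ 18) :=
    fin.trans (mul_le_mul_of_nonneg_left n8 (by positivity))
  have f4 : (M / Q) ^ 2 * b ≤ (M / Q) ^ 2 * (1 / 2 ^ 16 * N) := by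
    norm_num at f3 ⊢
    linarith
  exact le_of_mul_le_mul_left f4 hpos


section perline
variable {q : ℕ} [Fact q.Prime]

/-- permutations putting the triple on the plane -/
def zs (p : ZMod q × ZMod q × ZMod q) : Finset (Equiv.Perm (ZMod q)) :=
  Finset.univ.filter (fun π => π p.1 + π p.2.1 + π p.2.2 = 0)

theorem zs_upper (x y z : ZMod q) (hxz : x ≠ z) (hyz : y ≠ z) :
    (zs (x, y, z)).card * (q - 2) ≤ Fintype.card (Equiv.Perm (ZMod q)) := by
  have h := swap_upper (Finset.univ : Finset (Equiv.Perm (ZMod q))) z (Finset.univ \ {x, y})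
    (fun π => -(π x + π y)) (by simp) (by
      intro π _ v hv
      simp only [Finset.mem_sdiff, Finset.mem_univ, true_and, Finset.mem_insert,
        Finset.mem_singleton, not_or] at hv
      rw [swap_fix π hxz (Ne.symm hv.1), swap_fix π hyz (Ne.symm hv.2)])
  have e : zs (x, y, z) = Finset.univ.filter (fun π : Equiv.Perm (ZMod q) => π z = -(π x + π y)) := by
    ext π
    simp only [zs, Finset.mem_filter, Finset.mem_univ, true_and]
    constructor
    · intro h; linear_combination h
    · intro h; linear_combination h
  rw [e]
  refine le_trans (Nat.mul_le_mul_left _ ?_) h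
  rw [Finset.card_sdiff_of_subset (Finset.subset_univ _), Finset.card_univ, ZMod.card]
  have : ({x, y} : Finset (ZMod q)).card ≤ 2 := Finset.card_le_two
  omega

theorem zs_pair (x y z w a b : ZMod q) (h1 : x ≠ w) (h2 : y ≠ w) (h3 : z ≠ w) (h4 : a ≠ w)
    (h5 : b ≠ w) :
    ((zs (x, y, z)).filter (fun π => π w + π a + π b = 0)).card * (q - 5) ≤ (zs (x, y, z)).card := by
  have h := swap_upper (zs (x, y, z)) w (Finset.univ \ {x, y, z, a, b})
    (fun π => -(π a + π b)) (by
      intro π hπ v hv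
      simp only [Finset.mem_sdiff, Finset.mem_univ, true_and, Finset.mem_insert,
        Finset.mem_singleton, not_or] at hv
      simp only [zs, Finset.mem_filter, Finset.mem_univ, true_and] at hπ ⊢
      rw [swap_fix π h1 (Ne.symm hv.1), swap_fix π h2 (Ne.symm hv.2.1),
        swap_fix π h3 (Ne.symm hv.2.2.1), hπ]) (by
      intro π _ v hv
      simp only [Finset.mem_sdiff, Finset.mem_univ, true_and, Finset.mem_insert,
        Finset.mem_singleton, not_or] at hv
      rw [swap_fix π h4 (Ne.symm hv.2.2.2.1), swap_fix π h5 (Ne.symm hv.2.2.2.2)])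
  have e : (zs (x, y, z)).filter (fun π => π w + π a + π b = 0) =
      (zs (x, y, z)).filter (fun π => π w = -(π a + π b)) := by
    apply Finset.filter_congr
    intro π _
    constructor
    · intro h; linear_combination h
    · intro h; linear_combination h
  rw [e]
  refine le_trans (Nat.mul_le_mul_left _ ?_) h
  rw [Finset.card_sdiff_of_subset (Finset.subset_univ _), Finset.card_univ, ZMod.card]
  have : ({x, y, z, a, b} : Finset (ZMod q)).card ≤ 5 := Finset.card_le_five
  omega

theorem zs_bad (x y : ZMod q) (hxy : x ≠ y) :
    (Finset.univ.filter (fun π : Equiv.Perm (ZMod q) => π x = -(π x + π y))).card * (q - 1) ≤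
      Fintype.card (Equiv.Perm (ZMod q)) := by
  have h := swap_upper (Finset.univ : Finset (Equiv.Perm (ZMod q))) y (Finset.univ \ {x})
    (fun π => -(π x + π x)) (by simp) (by
      intro π _ v hv
      simp only [Finset.mem_sdiff, Finset.mem_univ, true_and, Finset.mem_singleton] at hv
      rw [swap_fix π hxy (Ne.symm hv)])
  have e : (Finset.univ.filter (fun π : Equiv.Perm (ZMod q) => π x = -(π x + π y))) =
      Finset.univ.filter (fun π : Equiv.Perm (ZMod q) => π y = -(π x + π x)) := by
    apply Finset.filter_congr
    intro π _
    constructor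
    · intro h; linear_combination h
    · intro h; linear_combination h
  rw [e]
  refine le_trans (Nat.mul_le_mul_left _ ?_) h
  rw [Finset.card_sdiff_of_subset (Finset.subset_univ _), Finset.card_univ, ZMod.card]
  simp

theorem zs_lower (x y z : ZMod q) (hxy : x ≠ y) (hxz : x ≠ z) (hyz : y ≠ z) :
    (q - 1) * Fintype.card (Equiv.Perm (ZMod q)) ≤ (q - 1) * ((q - 2) * (zs (x, y, z)).card) +
      2 * Fintype.card (Equiv.Perm (ZMod q)) := by
  classical
  set N := Fintype.card (Equiv.Perm (ZMod q)) with hN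
  let b1 := (Finset.univ.filter (fun π : Equiv.Perm (ZMod q) => π x = -(π x + π y)))
  let b2 := (Finset.univ.filter (fun π : Equiv.Perm (ZMod q) => π y = -(π y + π x)))
  have h1 : b1.card * (q - 1) ≤ N := zs_bad x y hxy
  have h2 : b2.card * (q - 1) ≤ N := zs_bad y x hxy.symm
  let good := (Finset.univ : Finset (Equiv.Perm (ZMod q))) \ (b1 ∪ b2)
  have hg : good.card ≤ ((zs (x, y, z)) ×ˢ (Finset.univ \ {x, y} : Finset (ZMod q))).card := by
    apply Finset.card_le_card_of_injOn
      (fun σ : Equiv.Perm (ZMod q) => (σ * Equiv.swap z (σ.symm (-(σ x + σ y))), σ.symm (-(σ x + σ y))))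
    · intro σ hσ
      simp only [good, b1, b2, Finset.coe_sdiff, Finset.coe_univ, Set.mem_sdiff, Set.mem_univ, true_and,
        Finset.mem_coe, Finset.mem_union, Finset.mem_filter, Finset.mem_univ, not_or] at hσ
      have n1 : x ≠ σ.symm (-(σ x + σ y)) := by
        intro h
        apply hσ.1
        conv_lhs => rw [h]
        simp
      have n2 : y ≠ σ.symm (-(σ x + σ y)) := by
        intro h
        apply hσ.2
        conv_lhs => rw [h]
        simp [add_comm]
      simp only [Finset.coe_product, Set.mem_prod, Finset.mem_coe, zs, Finset.mem_filter,
        Finset.mem_univ, true_and, Finset.mem_sdiff, Finset.mem_insert, Finset.mem_singleton, not_or]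
      refine ⟨?_, n1.symm, n2.symm⟩
      rw [swap_fix σ hxz n1, swap_fix σ hyz n2, Equiv.Perm.mul_apply, Equiv.swap_apply_left]
      simp
    · intro σ _ σ' _ h
      simp only [Prod.mk.injEq] at h
      have h' := h.1
      rw [h.2] at h'
      exact mul_right_cancel h'
  have hs : (Finset.univ \ {x, y} : Finset (ZMod q)).card = q - 2 := by
    rw [Finset.card_sdiff_of_subset (Finset.subset_univ _), Finset.card_univ,
      ZMod.card, Finset.card_pair hxy]
  rw [Finset.card_product, hs] at hg
  have hc : N ≤ good.card + (b1.card + b2.card) := by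
    have e1 : good.card + (b1 ∪ b2).card = N := by
      rw [Finset.card_sdiff_add_card_eq_card (Finset.subset_univ _), Finset.card_univ]
    have := Finset.card_union_le b1 b2
    omega
  calc (q - 1) * N ≤ (q - 1) * ((zs (x, y, z)).card * (q - 2) + (b1.card + b2.card)) :=
        Nat.mul_le_mul_left _ (by omega)
    _ = (q - 1) * ((q - 2) * (zs (x, y, z)).card) + (b1.card * (q - 1) + b2.card * (q - 1)) := by ring
    _ ≤ _ := by omega

/-- ordered triples -/
def trip (A B : Finset (ZMod q)) : Finset (ZMod q × ZMod q × ZMod q) :=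
  (B ×ˢ (B ×ˢ A)).filter (fun p => p.1 ≠ p.2.1)

def trx (A B : Finset (ZMod q)) (π : Equiv.Perm (ZMod q)) : Finset (ZMod q × ZMod q × ZMod q) :=
  (trip A B).filter (fun p => π p.1 + π p.2.1 + π p.2.2 = 0)

theorem card_trip (A B : Finset (ZMod q)) :
    (trip A B).card + B.card * A.card = B.card * B.card * A.card := by
  have h := Finset.card_filter_add_card_filter_not
    (s := B ×ˢ (B ×ˢ A)) (fun p => p.1 ≠ p.2.1)
  have e : ((B ×ˢ (B ×ˢ A)).filter (fun p => ¬ p.1 ≠ p.2.1)).card = (B ×ˢ A).card := by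
    apply Finset.card_bij (fun p _ => p.2)
    · rintro ⟨x, y, z⟩ hp
      simp only [Finset.mem_filter, Finset.mem_product] at hp ⊢
      exact hp.1.2
    · rintro ⟨x, y, z⟩ hp ⟨x', y', z'⟩ hp' h
      simp only [Finset.mem_filter, not_not, Prod.mk.injEq] at hp hp' h ⊢
      exact ⟨by rw [hp.2, hp'.2, h.1], h⟩
    · rintro ⟨y, z⟩ hp
      refine ⟨(y, y, z), ?_, rfl⟩
      simp only [Finset.mem_filter, Finset.mem_product] at hp ⊢
      exact ⟨⟨hp.1, hp⟩, by simp⟩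
  rw [e, Finset.card_product, Finset.card_product, Finset.card_product] at h
  change (trip A B).card + _ = _ at h
  rw [h, mul_assoc]

set_option maxHeartbeats 1000000 in
theorem perline (hq : 2 ^ 30 ≤ q) (A B : Finset (ZMod q)) (hd : Disjoint A B)
    (hA : q ≤ 16 * A.card) (hB : 2 ^ 13 ≤ B.card) :
    ((Finset.univ.filter (fun π : Equiv.Perm (ZMod q) =>
      2 * q * (trx A B π).card < (trip A B).card)).card : ℝ) ≤
      1 / 2 ^ 16 * (Fintype.card (Equiv.Perm (ZMod q)) : ℝ) := by
  classical
  set N : ℝ := (Fintype.card (Equiv.Perm (ZMod q)) : ℝ) with hN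
  have hNpos : 0 < N := by rw [hN]; exact_mod_cast Fintype.card_pos
  set M : ℝ := ((trip A B).card : ℝ) with hM
  set Q : ℝ := (q : ℝ) with hQ
  have hQb : (2 : ℝ) ^ 30 ≤ Q := by rw [hQ]; exact_mod_cast hq
  set U : ℝ := N / (Q - 2) with hU
  have hQ2 : 0 < Q - 2 := by norm_num at hQb ⊢; linarith
  have hQ5 : 0 < Q - 5 := by norm_num at hQb ⊢; linarith
  have hQ1 : 0 < Q - 1 := by norm_num at hQb ⊢; linarith
  have hq2 : ((q - 2 : ℕ) : ℝ) = Q - 2 := by rw [Nat.cast_sub (by omega)]; rfl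
  have hq5 : ((q - 5 : ℕ) : ℝ) = Q - 5 := by rw [Nat.cast_sub (by omega)]; rfl
  have hq1 : ((q - 1 : ℕ) : ℝ) = Q - 1 := by rw [Nat.cast_sub (by omega)]; norm_num; rfl
  have mem : ∀ {x y z}, (x, y, z) ∈ trip A B → x ∈ B ∧ y ∈ B ∧ z ∈ A ∧ x ≠ y := by
    intro x y z h
    simp only [trip, Finset.mem_filter, Finset.mem_product] at h
    exact ⟨h.1.1, h.1.2.1, h.1.2.2, h.2⟩
  have hne : ∀ {x z}, x ∈ B → z ∈ A → x ≠ z := by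
    rintro x z h1 h2 rfl
    exact Finset.disjoint_left.mp hd h2 h1
  have up : ∀ p ∈ trip A B, ((zs p).card : ℝ) ≤ U := by
    rintro ⟨x, y, z⟩ hp
    obtain ⟨a1, a2, a3, a4⟩ := mem hp
    rw [hU, le_div_iff₀ hQ2, ← hq2, hN]
    exact_mod_cast zs_upper x y z (hne a1 a3) (hne a2 a3)
  have lo : ∀ p ∈ trip A B, N * (Q - 3) / ((Q - 1) * (Q - 2)) ≤ ((zs p).card : ℝ) := by
    rintro ⟨x, y, z⟩ hp
    obtain ⟨a1, a2, a3, a4⟩ := mem hp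
    rw [div_le_iff₀ (by positivity)]
    have h : (Q - 1) * N ≤ (Q - 1) * ((Q - 2) * ((zs (x, y, z)).card : ℝ)) + 2 * N := by
      rw [← hq1, ← hq2, hN]
      exact_mod_cast zs_lower x y z a4 (hne a1 a3) (hne a2 a3)
    linarith
  have pair : ∀ p ∈ trip A B, ∀ p' ∈ trip A B,
      (((zs p).filter (fun π => π ∈ zs p')).card : ℝ) ≤ U / (Q - 5) +
        ((if p' = p then U else 0) + (if p' = (p.2.1, p.1, p.2.2) then U else 0)) := by
    rintro ⟨x, y, z⟩ hp ⟨x', y', z'⟩ hp'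
    obtain ⟨a1, a2, a3, a4⟩ := mem hp
    obtain ⟨b1, b2, b3, b4⟩ := mem hp'
    have hUpos : 0 < U := by positivity
    have key : ∀ w a b : ZMod q, (∀ π : Equiv.Perm (ZMod q), π ∈ zs (x', y', z') ↔ π w + π a + π b = 0) →
        x ≠ w → y ≠ w → z ≠ w → a ≠ w → b ≠ w →
        (((zs (x, y, z)).filter (fun π => π ∈ zs (x', y', z'))).card : ℝ) ≤ U / (Q - 5) := by
      intro w a b hw h1 h2 h3 h4 h5
      rw [Finset.filter_congr (fun π _ => hw π), le_div_iff₀ hQ5, ← hq5]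
      refine le_trans ?_ (up _ hp)
      exact_mod_cast zs_pair x y z w a b h1 h2 h3 h4 h5
    have nn : 0 ≤ ((if (x', y', z') = (x, y, z) then U else 0) +
        (if (x', y', z') = (y, x, z) then U else 0)) := by
      apply add_nonneg <;> split_ifs <;> linarith
    have hm : ∀ π : Equiv.Perm (ZMod q), π ∈ zs (x', y', z') ↔ π x' + π y' + π z' = 0 := by
      intro π; simp [zs]
    by_cases c1 : z' = z
    · subst c1
      by_cases c2 : x' = x ∨ x' = y
      · by_cases c3 : y' = x ∨ y' = y
        · have hle : (((zs (x, y, z')).filter (fun π => π ∈ zs (x', y', z'))).card : ℝ) ≤ U := by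
            refine le_trans ?_ (up _ hp)
            exact_mod_cast Finset.card_filter_le _ _
          have hpos : 0 < U / (Q - 5) := by positivity
          simp only
          rcases c2 with rfl | rfl
          · rcases c3 with rfl | rfl
            · exact absurd rfl b4
            · rw [if_pos rfl]
              have : 0 ≤ (if (x', y', z') = (y', x', z') then U else 0) := by
                split_ifs <;> linarith
              linarith
          · rcases c3 with rfl | rfl
            · rw [if_pos (rfl : (x', y', z') = (x', y', z'))]
              have : 0 ≤ (if (x', y', z') = (y', x', z') then U else 0) := by
                split_ifs <;> linarith
              linarith
            · exact absurd rfl b4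
        · push Not at c3
          have := key y' x' z' (fun π => by rw [hm]; constructor <;> intro h <;> linear_combination h)
            (Ne.symm c3.1) (Ne.symm c3.2) (hne b2 b3).symm b4 (hne b2 b3).symm
          simp only
          linarith
      · push Not at c2
        have := key x' y' z' hm
          (Ne.symm c2.1) (Ne.symm c2.2) (hne b1 b3).symm b4.symm (hne b1 b3).symm
        simp only
        linarith
    · have := key z' x' y' (fun π => by rw [hm]; constructor <;> intro h <;> linear_combination h)
          (hne a1 b3) (hne a2 b3) (Ne.symm c1) (hne b1 b3) (hne b2 b3)
      simp only
      linarith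
  -- moments
  let X : Equiv.Perm (ZMod q) → ℝ := fun π => ((trx A B π).card : ℝ)
  have hX : ∀ π, X π = ∑ p ∈ trip A B, (if π ∈ zs p then (1 : ℝ) else 0) := by
    intro π
    simp only [X, trx, zs, Finset.mem_filter, Finset.mem_univ, true_and]
    rw [Finset.sum_ite, Finset.sum_const_zero, add_zero, Finset.sum_const, nsmul_eq_mul, mul_one]
  have m1 : M * (N * (Q - 3) / ((Q - 1) * (Q - 2))) ≤ ∑ π, X π := by
    simp only [hX]
    rw [Finset.sum_comm]
    rw [hM, ← nsmul_eq_mul]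
    apply Finset.card_nsmul_le_sum
    intro p hp
    refine le_trans (lo p hp) (le_of_eq ?_)
    rw [Finset.sum_boole]
    simp
  have m2 : ∑ π, X π ^ 2 ≤ M * (M * (U / (Q - 5)) + 2 * U) := by
    have e : ∑ π, X π ^ 2 = ∑ p ∈ trip A B, ∑ p' ∈ trip A B,
        (((zs p).filter (fun π => π ∈ zs p')).card : ℝ) := by
      simp only [hX, sq, Finset.sum_mul_sum]
      rw [Finset.sum_comm]
      apply Finset.sum_congr rfl
      intro p _
      rw [Finset.sum_comm]
      apply Finset.sum_congr rfl
      intro p' _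
      simp only [← ite_and, mul_ite, mul_one, mul_zero]
      rw [Finset.sum_boole]
      congr 2
      ext π
      simp [and_comm]
    rw [e, hM, ← nsmul_eq_mul]
    apply Finset.sum_le_card_nsmul
    intro p hp
    refine le_trans (Finset.sum_le_sum (pair p hp)) ?_
    rw [Finset.sum_add_distrib, Finset.sum_add_distrib, Finset.sum_const, nsmul_eq_mul,
      Finset.sum_ite_eq', Finset.sum_ite_eq']
    have hUpos : 0 < U := by positivity
    have s1 : (if p ∈ trip A B then U else 0) ≤ U := by split_ifs <;> linarith
    have s2 : (if (p.2.1, p.1, p.2.2) ∈ trip A B then U else 0) ≤ U := by split_ifs <;> linarith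
    linarith
  have hMb : Q * 2 ^ 20 ≤ M := by
    have h := card_trip A B
    have h' : M + (B.card : ℝ) * A.card = (B.card : ℝ) * B.card * A.card := by
      rw [hM]; exact_mod_cast h
    have hb : (2 : ℝ) ^ 13 ≤ B.card := by exact_mod_cast hB
    have ha : Q ≤ 16 * A.card := by rw [hQ]; exact_mod_cast hA
    have : (2 : ℝ) ^ 13 * (2 ^ 13 - 1) ≤ (B.card : ℝ) * (B.card - 1) := by
      have e1 : (2 : ℝ) ^ 13 - 1 ≤ (B.card : ℝ) - 1 := by linarith
      exact mul_le_mul hb e1 (by norm_num) (by positivity)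
    have h3 : (2 : ℝ) ^ 13 * (2 ^ 13 - 1) * A.card ≤ (B.card : ℝ) * (B.card - 1) * A.card :=
      mul_le_mul_of_nonneg_right this (by positivity)
    norm_num at h3 ⊢
    nlinarith
  have hMpos : 0 < M := by
    have : 0 < Q := by linarith
    nlinarith
  set bad := (Finset.univ.filter (fun π : Equiv.Perm (ZMod q) =>
      2 * q * (trx A B π).card < (trip A B).card)) with hbad
  have ch : (bad.card : ℝ) * (M / Q) ^ 2 / 4 ≤ ∑ π, (X π - M / Q) ^ 2 := by
    have h1 : ∑ π ∈ bad, (X π - M / Q) ^ 2 ≤ ∑ π, (X π - M / Q) ^ 2 :=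
      Finset.sum_le_sum_of_subset_of_nonneg (Finset.subset_univ _) (fun _ _ _ => sq_nonneg _)
    refine le_trans ?_ h1
    rw [mul_div_assoc, ← nsmul_eq_mul]
    apply Finset.card_nsmul_le_sum
    intro π hπ
    have hlt : 2 * Q * X π < M := by
      have := (Finset.mem_filter.mp hπ).2
      simp only [X, hM, hQ]
      exact_mod_cast this
    have hQ0 : 0 < Q := by linarith
    have : X π < M / Q / 2 := by
      rw [div_div, lt_div_iff₀ (by positivity)]; linarith
    have hp : 0 < M / Q := by positivity
    nlinarith
  have ex : ∑ π, (X π - M / Q) ^ 2 = ∑ π, X π ^ 2 - 2 * (M / Q) * ∑ π, X π + (M / Q) ^ 2 * N := by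
    simp only [sub_sq, Finset.sum_add_distrib, Finset.sum_sub_distrib, Finset.sum_const,
      Finset.card_univ, nsmul_eq_mul, ← hN]
    rw [Finset.mul_sum]
    congr 1
    · congr 1
      apply Finset.sum_congr rfl; intros; ring
    · ring
  have hQ0 : 0 < Q := by linarith
  have fin : (bad.card : ℝ) * (M / Q) ^ 2 / 4 ≤
      M * (M * (U / (Q - 5)) + 2 * U) - 2 * (M / Q) * (M * (N * (Q - 3) / ((Q - 1) * (Q - 2)))) +
        (M / Q) ^ 2 * N := by
    rw [ex] at ch
    have : 2 * (M / Q) * (M * (N * (Q - 3) / ((Q - 1) * (Q - 2)))) ≤ 2 * (M / Q) * ∑ π, X π :=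
      mul_le_mul_of_nonneg_left m1 (by positivity)
    linarith
  exact perline_num N M Q (bad.card : ℝ) hNpos hQb hMb (by rw [← hU]; exact fin)

end perline


section lines
variable {q : ℕ} [Fact q.Prime]

/-- section of a point set along a line -/
def sec (A : Finset (ZMod q × ZMod q)) (l : ZMod q × ZMod q) : Finset (ZMod q) :=
  Finset.univ.filter (fun x => (x, l.1 * x + l.2) ∈ A)

theorem card_sec (A : Finset (ZMod q × ZMod q)) (l : ZMod q × ZMod q) :
    (sec A l).card = (A.filter (fun p => p.2 = l.1 * p.1 + l.2)).card := by
  apply Finset.card_bij (fun x _ => (x, l.1 * x + l.2))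
  · intro x hx
    simp only [sec, Finset.mem_filter, Finset.mem_univ, true_and] at hx ⊢
    exact ⟨hx, trivial⟩
  · intro x _ y _ h
    exact (Prod.mk.inj h).1
  · rintro ⟨x, y⟩ h
    simp only [Finset.mem_filter] at h
    refine ⟨x, ?_, ?_⟩
    · simp only [sec, Finset.mem_filter, Finset.mem_univ, true_and]
      rw [← h.2]; exact h.1
    · rw [h.2]

theorem card_lines (p : ZMod q × ZMod q) :
    (Finset.univ.filter (fun l : ZMod q × ZMod q => p.2 = l.1 * p.1 + l.2)).card = q := by
  have : (Finset.univ : Finset (ZMod q)).card = q := by rw [Finset.card_univ, ZMod.card]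
  refine Eq.trans ?_ this
  symm
  apply Finset.card_bij (fun m _ => (m, p.2 - m * p.1))
  · intro m _
    simp
  · intro x _ y _ h
    exact (Prod.mk.inj h).1
  · rintro ⟨m, c⟩ h
    simp only [Finset.mem_filter, Finset.mem_univ, true_and] at h
    exact ⟨m, Finset.mem_univ _, by rw [h]; simp⟩

theorem line_unique {m c m' c' x x' : ZMod q} (hx : x ≠ x') (h1 : m * x + c = m' * x + c')
    (h2 : m * x' + c = m' * x' + c') : m = m' ∧ c = c' := by
  have : (m - m') * (x - x') = 0 := by linear_combination h1 - h2
  have hm : m = m' := by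
    rcases mul_eq_zero.mp this with h | h
    · exact sub_eq_zero.mp h
    · exact absurd (sub_eq_zero.mp h) hx
  subst hm
  exact ⟨rfl, by linear_combination h1⟩

theorem card_lines_two (p p' : ZMod q × ZMod q) (hne : p ≠ p') :
    (Finset.univ.filter (fun l : ZMod q × ZMod q =>
      p.2 = l.1 * p.1 + l.2 ∧ p'.2 = l.1 * p'.1 + l.2)).card ≤ 1 := by
  rw [Finset.card_le_one]
  rintro ⟨m, c⟩ h ⟨m', c'⟩ h'
  simp only [Finset.mem_filter, Finset.mem_univ, true_and] at h h'
  have hx : p.1 ≠ p'.1 := by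
    intro hx
    apply hne
    apply Prod.ext hx
    rw [h.1, h.2, hx]
  obtain ⟨rfl, rfl⟩ := line_unique hx (h.1.symm.trans h'.1) (h.2.symm.trans h'.2)
  rfl

theorem few_poor (A : Finset (ZMod q × ZMod q)) :
    ((Finset.univ.filter (fun l : ZMod q × ZMod q => 2 * q * (sec A l).card < A.card)).card) * A.card ≤
      4 * q ^ 3 := by
  classical
  have hq0 : 0 < q := (Fact.out : q.Prime).pos
  by_cases hA : A.card = 0
  · rw [hA]; simp
  have hApos : (0 : ℝ) < A.card := by exact_mod_cast Nat.pos_of_ne_zero hA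
  let X : ZMod q × ZMod q → ℝ := fun l => ((sec A l).card : ℝ)
  have hX : ∀ l, X l = ∑ p ∈ A, (if p.2 = l.1 * p.1 + l.2 then (1 : ℝ) else 0) := by
    intro l
    simp only [X]
    rw [card_sec, Finset.sum_boole]
  have m1 : ∑ l, X l = q * A.card := by
    simp only [hX]
    rw [Finset.sum_comm]
    rw [Finset.sum_congr rfl (g := fun _ => (q : ℝ))]
    · rw [Finset.sum_const, nsmul_eq_mul, mul_comm]
    · intro p _
      rw [Finset.sum_boole, card_lines]
  have m2 : ∑ l, X l ^ 2 ≤ A.card * ((q : ℝ) + A.card) := by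
    simp only [hX, sq, Finset.sum_mul_sum]
    rw [Finset.sum_comm, ← nsmul_eq_mul]
    apply Finset.sum_le_card_nsmul
    intro p hp
    rw [Finset.sum_comm]
    have : ∀ p' ∈ A, (∑ l : ZMod q × ZMod q, (if p.2 = l.1 * p.1 + l.2 then (1 : ℝ) else 0) *
        (if p'.2 = l.1 * p'.1 + l.2 then (1 : ℝ) else 0)) ≤ (if p' = p then (q : ℝ) else 0) + 1 := by
      intro p' _
      simp only [← ite_and, mul_ite, mul_one, mul_zero]
      rw [Finset.sum_boole]
      by_cases h : p' = p
      · subst h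
        rw [if_pos rfl]
        have h2 : (Finset.univ.filter (fun l : ZMod q × ZMod q =>
          p'.2 = l.1 * p'.1 + l.2 ∧ p'.2 = l.1 * p'.1 + l.2)).card ≤ q := by
          simp only [and_self]
          exact (card_lines p').le
        have : ((Finset.univ.filter (fun l : ZMod q × ZMod q =>
          p'.2 = l.1 * p'.1 + l.2 ∧ p'.2 = l.1 * p'.1 + l.2)).card : ℝ) ≤ q := by exact_mod_cast h2
        linarith
      · rw [if_neg h, zero_add]
        exact_mod_cast card_lines_two p' p h
    refine (Finset.sum_le_sum this).trans ?_
    rw [Finset.sum_add_distrib, Finset.sum_ite_eq', if_pos hp]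
    simp
  set bad := (Finset.univ.filter (fun l : ZMod q × ZMod q => 2 * q * (sec A l).card < A.card)) with hbad
  set a : ℝ := (A.card : ℝ) with ha
  set Q : ℝ := (q : ℝ) with hQ
  have hQ0 : 0 < Q := by rw [hQ]; exact_mod_cast hq0
  have ch : (bad.card : ℝ) * (a ^ 2 / 4) ≤ ∑ l, (Q * X l - a) ^ 2 := by
    have h1 : ∑ l ∈ bad, (Q * X l - a) ^ 2 ≤ ∑ l, (Q * X l - a) ^ 2 :=
      Finset.sum_le_sum_of_subset_of_nonneg (Finset.subset_univ _) (fun _ _ _ => sq_nonneg _)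
    refine le_trans ?_ h1
    rw [← nsmul_eq_mul]
    apply Finset.card_nsmul_le_sum
    intro l hl
    have hlt : 2 * Q * X l < a := by
      have := (Finset.mem_filter.mp hl).2
      simp only [X, ha, hQ]
      exact_mod_cast this
    nlinarith
  have ex : ∑ l, (Q * X l - a) ^ 2 = Q ^ 2 * ∑ l, X l ^ 2 - 2 * Q * a * ∑ l, X l + Q ^ 2 * a ^ 2 := by
    simp only [sub_sq, Finset.sum_add_distrib, Finset.sum_sub_distrib, Finset.sum_const,
      Finset.card_univ, nsmul_eq_mul, Fintype.card_prod, ZMod.card]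
    rw [Finset.mul_sum, Finset.mul_sum]
    congr 1
    · congr 1
      · apply Finset.sum_congr rfl; intros; ring
      · apply Finset.sum_congr rfl; intros; ring
    · push_cast; rw [← hQ]; ring
  rw [ex, m1] at ch
  have f : (bad.card : ℝ) * (a ^ 2 / 4) ≤ Q ^ 3 * a := by
    have : Q ^ 2 * ∑ l, X l ^ 2 ≤ Q ^ 2 * (a * (Q + a)) := mul_le_mul_of_nonneg_left m2 (by positivity)
    nlinarith
  have f2 : (bad.card : ℝ) * a ≤ 4 * Q ^ 3 := by
    have : a * ((bad.card : ℝ) * a) ≤ a * (4 * Q ^ 3) := by nlinarith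
    exact le_of_mul_le_mul_left this hApos
  rw [ha, hQ] at f2
  exact_mod_cast f2

/-- the lines where neither set is poor -/
def rich (A B : Finset (ZMod q × ZMod q)) : Finset (ZMod q × ZMod q) :=
  Finset.univ.filter (fun l => A.card ≤ 2 * q * (sec A l).card ∧ B.card ≤ 2 * q * (sec B l).card)

theorem card_rich (hq : 2 ^ 30 ≤ q) (A B : Finset (ZMod q × ZMod q)) (hA : q ^ 2 ≤ 8 * A.card)
    (hB : 2 ^ 14 * q ≤ B.card) : 3 * q ^ 2 ≤ 4 * (rich A B).card := by
  classical
  set b1 := (Finset.univ.filter (fun l : ZMod q × ZMod q => 2 * q * (sec A l).card < A.card)) with hb1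
  set b2 := (Finset.univ.filter (fun l : ZMod q × ZMod q => 2 * q * (sec B l).card < B.card)) with hb2
  have h1 : b1.card * A.card ≤ 4 * q ^ 3 := few_poor A
  have h2 : b2.card * B.card ≤ 4 * q ^ 3 := few_poor B
  have hq0 : 0 < q := by omega
  have k1 : b1.card ≤ 32 * q := by
    have : b1.card * q ^ 2 ≤ (32 * q) * q ^ 2 := by
      calc b1.card * q ^ 2 ≤ b1.card * (8 * A.card) := Nat.mul_le_mul_left _ hA
        _ = 8 * (b1.card * A.card) := by ring
        _ ≤ 8 * (4 * q ^ 3) := Nat.mul_le_mul_left _ h1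
        _ = _ := by ring
    exact Nat.le_of_mul_le_mul_right this (by positivity)
  have k2 : b2.card * 2 ^ 14 ≤ 4 * q ^ 2 := by
    have : (b2.card * 2 ^ 14) * q ≤ (4 * q ^ 2) * q := by
      calc (b2.card * 2 ^ 14) * q = b2.card * (2 ^ 14 * q) := by ring
        _ ≤ b2.card * B.card := Nat.mul_le_mul_left _ hB
        _ ≤ (4 * q ^ 3) := h2
        _ = _ := by ring
    exact Nat.le_of_mul_le_mul_right this hq0
  have hc : q ^ 2 ≤ (rich A B).card + (b1.card + b2.card) := by
    have e : (Finset.univ : Finset (ZMod q × ZMod q)) ⊆ rich A B ∪ (b1 ∪ b2) := by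
      intro l _
      simp only [rich, hb1, hb2, Finset.mem_union, Finset.mem_filter, Finset.mem_univ, true_and]
      omega
    have h3 := Finset.card_le_card e
    rw [Finset.card_univ, Fintype.card_prod, ZMod.card, ← sq] at h3
    have h4 := Finset.card_union_le (rich A B) (b1 ∪ b2)
    have h5 := Finset.card_union_le b1 b2
    omega
  have : 32 * q * 2 ^ 14 ≤ q ^ 2 := by nlinarith
  omega

/-- deficient permutations for a line -/
def defi (A B : Finset (ZMod q)) : Finset (Equiv.Perm (ZMod q)) :=
  Finset.univ.filter (fun π => 2 * q * (trx A B π).card < (trip A B).card)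

theorem sec_disj {A B : Finset (ZMod q × ZMod q)} (h : Disjoint A B) (l) :
    Disjoint (sec A l) (sec B l) := by
  rw [Finset.disjoint_left] at h ⊢
  intro x hx hy
  simp only [sec, Finset.mem_filter, Finset.mem_univ, true_and] at hx hy
  exact h hx hy

theorem rich_sizes (hq : 2 ^ 30 ≤ q) {A B : Finset (ZMod q × ZMod q)} (hA : q ^ 2 ≤ 8 * A.card)
    (hB : 2 ^ 14 * q ≤ B.card) {l} (hl : l ∈ rich A B) :
    q ≤ 16 * (sec A l).card ∧ 2 ^ 13 ≤ (sec B l).card := by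
  have hq0 : 0 < q := by omega
  have h := (Finset.mem_filter.mp hl).2
  constructor
  · have : q * q ≤ q * (16 * (sec A l).card) := by nlinarith [h.1]
    exact Nat.le_of_mul_le_mul_left this hq0
  · have : q * 2 ^ 13 ≤ q * (sec B l).card := by nlinarith [h.2]
    exact Nat.le_of_mul_le_mul_left this hq0

theorem exists_omega (hq : 2 ^ 30 ≤ q) :
    ∃ ω : ZMod q × ZMod q → Equiv.Perm (ZMod q), ∀ A B : Finset (ZMod q × ZMod q),
      Disjoint A B → q ^ 2 ≤ 8 * A.card → 2 ^ 14 * q ≤ B.card →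
      4 * ((rich A B).filter (fun l => ω l ∈ defi (sec A l) (sec B l))).card < q ^ 2 := by
  classical
  by_contra hcon
  push Not at hcon
  let P := ZMod q × ZMod q
  let Ω := P → Equiv.Perm (ZMod q)
  let I := Finset P × Finset P × Finset P
  let ok : I → Prop := fun i => Disjoint i.1 i.2.1 ∧ q ^ 2 ≤ 8 * i.1.card ∧ 2 ^ 14 * q ≤ i.2.1.card ∧
    i.2.2 ⊆ rich i.1 i.2.1 ∧ q ^ 2 ≤ 4 * i.2.2.card
  let bad : I → Finset Ω := fun i =>
    Finset.univ.filter (fun g : Ω => ∀ l ∈ i.2.2, g l ∈ defi (sec i.1 l) (sec i.2.1 l))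
  have cov : (Finset.univ : Finset Ω) ⊆ (Finset.univ.filter ok).biUnion bad := by
    intro ω _
    obtain ⟨A, B, h1, h2, h3, h4⟩ := hcon ω
    rw [Finset.mem_biUnion]
    refine ⟨(A, B, (rich A B).filter (fun l => ω l ∈ defi (sec A l) (sec B l))), ?_, ?_⟩
    · rw [Finset.mem_filter]
      exact ⟨Finset.mem_univ _, h1, h2, h3, Finset.filter_subset _ _, h4⟩
    · simp only [bad, Finset.mem_filter, Finset.mem_univ, true_and]
      intro l hl
      exact hl.2
  have hcard : Fintype.card P = q ^ 2 := by
    simp only [P]; rw [Fintype.card_prod, ZMod.card, sq]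
  have hb : ∀ i ∈ Finset.univ.filter ok, ((bad i).card : ℝ) ≤ (1 / 16) ^ (q ^ 2) * (Fintype.card Ω : ℝ) := by
    rintro ⟨A, B, L⟩ hi
    obtain ⟨h1, h2, h3, h4, h5⟩ := (Finset.mem_filter.mp hi).2
    simp only at h1 h2 h3 h4 h5
    have := card_pi_le L (fun l => defi (sec A l) (sec B l)) (1 / 2 ^ 16 : ℝ) (by
      intro l hl
      obtain ⟨s1, s2⟩ := rich_sizes hq h2 h3 (h4 hl)
      exact perline hq _ _ (sec_disj h1 l) s1 s2)
    refine this.trans ?_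
    apply mul_le_mul_of_nonneg_right _ (by positivity)
    have e : (1 / 2 ^ 16 : ℝ) = (1 / 16) ^ 4 := by norm_num
    rw [e, ← pow_mul]
    exact pow_le_pow_of_le_one (by norm_num) (by norm_num) h5
  have hle : (Fintype.card Ω : ℝ) ≤ (2 ^ (q ^ 2) * (2 ^ (q ^ 2) * 2 ^ (q ^ 2))) *
      ((1 / 16) ^ (q ^ 2) * (Fintype.card Ω : ℝ)) := by
    have h1 := (Finset.card_le_card cov).trans Finset.card_biUnion_le
    rw [Finset.card_univ] at h1
    have h2 : (Fintype.card Ω : ℝ) ≤ ∑ i ∈ Finset.univ.filter ok, ((bad i).card : ℝ) := by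
      exact_mod_cast h1
    refine h2.trans ((Finset.sum_le_card_nsmul _ _ _ hb).trans ?_)
    rw [nsmul_eq_mul]
    apply mul_le_mul_of_nonneg_right _ (by positivity)
    have h3 : (Finset.univ.filter ok).card ≤ Fintype.card I := Finset.card_le_univ _
    have h4 : Fintype.card I = 2 ^ (q ^ 2) * (2 ^ (q ^ 2) * 2 ^ (q ^ 2)) := by
      simp only [I, Fintype.card_prod, Fintype.card_finset, hcard]
    rw [h4] at h3
    exact_mod_cast h3
  have hpos : (0 : ℝ) < Fintype.card Ω := by exact_mod_cast Fintype.card_pos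
  have e : ((2 : ℝ) ^ (q ^ 2) * (2 ^ (q ^ 2) * 2 ^ (q ^ 2))) * ((1 / 16) ^ (q ^ 2) * (Fintype.card Ω : ℝ)) =
      (1 / 2) ^ (q ^ 2) * (Fintype.card Ω : ℝ) := by
    rw [← mul_assoc, ← mul_pow, ← mul_pow, ← mul_pow]; norm_num
  rw [e] at hle
  have : ((1 : ℝ) / 2) ^ (q ^ 2) < 1 := by
    apply pow_lt_one₀ (by norm_num) (by norm_num)
    have : 0 < q := by omega
    positivity
  nlinarith

/-- the linear system of triples -/
def TT (ω : ZMod q × ZMod q → Equiv.Perm (ZMod q)) (a b c : ZMod q × ZMod q) : Prop :=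
  a ≠ b ∧ b ≠ c ∧ a ≠ c ∧ ∃ l : ZMod q × ZMod q, a.2 = l.1 * a.1 + l.2 ∧ b.2 = l.1 * b.1 + l.2 ∧
    c.2 = l.1 * c.1 + l.2 ∧ ω l a.1 + ω l b.1 + ω l c.1 = 0

theorem TT_linear {ω : ZMod q × ZMod q → Equiv.Perm (ZMod q)} {a b c c'} (h : TT ω a b c)
    (h' : TT ω a b c') : c = c' := by
  obtain ⟨n1, n2, n3, l, e1, e2, e3, e4⟩ := h
  obtain ⟨_, _, _, l', f1, f2, f3, f4⟩ := h'
  have hx : a.1 ≠ b.1 := by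
    intro hx
    apply n1
    apply Prod.ext hx
    rw [e1, e2, hx]
  obtain ⟨r1, r2⟩ := line_unique hx (e1.symm.trans f1) (e2.symm.trans f2)
  have hl : l = l' := Prod.ext r1 r2
  subst hl
  have : ω l c.1 = ω l c'.1 := by linear_combination e4 - f4
  have h1 : c.1 = c'.1 := (ω l).injective this
  apply Prod.ext h1
  rw [e3, f3, h1]

theorem exists_T (hq : 2 ^ 30 ≤ q) :
    ∃ T : ZMod q × ZMod q → ZMod q × ZMod q → ZMod q × ZMod q → Prop,
      (∀ a b c, T a b c → T b a c) ∧ (∀ a b c, T a b c → T a c b) ∧ (∀ a b c, T a b c → a ≠ b) ∧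
      (∀ a b c c', T a b c → T a b c' → c = c') ∧
      (∀ A B : Finset (ZMod q × ZMod q), Disjoint A B → q ^ 2 ≤ 8 * A.card → 2 ^ 14 * q ≤ B.card →
        ∃ X ⊆ B ×ˢ B, (∀ p ∈ X, ∃ z ∈ A, T p.1 p.2 z) ∧ B.card ^ 2 ≤ 512 * X.card) := by
  classical
  obtain ⟨ω, hω⟩ := exists_omega hq
  refine ⟨TT ω, ?_, ?_, ?_, ?_, ?_⟩
  · rintro a b c ⟨n1, n2, n3, l, e1, e2, e3, e4⟩
    exact ⟨n1.symm, n3, n2, l, e2, e1, e3, by linear_combination e4⟩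
  · rintro a b c ⟨n1, n2, n3, l, e1, e2, e3, e4⟩
    exact ⟨n3, n2.symm, n1, l, e1, e3, e2, by linear_combination e4⟩
  · rintro a b c ⟨n1, -⟩
    exact n1
  · intro a b c c' h h'
    exact TT_linear h h'
  intro A B hd hA hB
  refine ⟨(B ×ˢ B).filter (fun p => ∃ z ∈ A, TT ω p.1 p.2 z), Finset.filter_subset _ _,
    fun p hp => (Finset.mem_filter.mp hp).2, ?_⟩
  set X := (B ×ˢ B).filter (fun p => ∃ z ∈ A, TT ω p.1 p.2 z) with hX
  have hrich := card_rich hq A B hA hB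
  have hdef := hω A B hd hA hB
  set L := (rich A B).filter (fun l => ¬ (ω l ∈ defi (sec A l) (sec B l))) with hL
  have hLc : q ^ 2 ≤ 2 * L.card := by
    have : ((rich A B).filter (fun l => ω l ∈ defi (sec A l) (sec B l))).card + L.card =
        (rich A B).card := by
      rw [hL]
      convert Finset.card_filter_add_card_filter_not (s := rich A B)
        (fun l => ω l ∈ defi (sec A l) (sec B l))
    omega
  have hq0 : 0 < q := by omega
  have key : ∀ l ∈ L, B.card ^ 2 ≤ 256 * q ^ 2 * (trx (sec A l) (sec B l) (ω l)).card := by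
    intro l hl
    have hl1 := (Finset.mem_filter.mp hl).1
    have hl2 := (Finset.mem_filter.mp hl).2
    simp only [defi, Finset.mem_filter, Finset.mem_univ, true_and, not_lt] at hl2
    obtain ⟨s1, s2⟩ := rich_sizes hq hA hB hl1
    have s3 := (Finset.mem_filter.mp hl1).2.2
    have h1 := card_trip (sec A l) (sec B l)
    set t := (sec B l).card
    set a := (sec A l).card
    set x := (trx (sec A l) (sec B l) (ω l)).card
    have h2 : t * t * a ≤ 2 * (trip (sec A l) (sec B l)).card := by nlinarith
    have h3 : q * (t * t) ≤ q * (64 * x) := by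
      calc q * (t * t) ≤ 16 * a * (t * t) := Nat.mul_le_mul_right _ s1
        _ = 16 * (t * t * a) := by ring
        _ ≤ 16 * (2 * (2 * q * x)) := Nat.mul_le_mul_left _ (by omega)
        _ = q * (64 * x) := by ring
    have h4 := Nat.le_of_mul_le_mul_left h3 hq0
    calc B.card ^ 2 ≤ (2 * q * t) ^ 2 := Nat.pow_le_pow_left s3 2
      _ = 4 * q ^ 2 * (t * t) := by ring
      _ ≤ 4 * q ^ 2 * (64 * x) := Nat.mul_le_mul_left _ h4
      _ = _ := by ring
  have hinj : (L.sigma (fun l => trx (sec A l) (sec B l) (ω l))).card ≤ X.card := by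
    have mem : ∀ l x y z, (x, y, z) ∈ trx (sec A l) (sec B l) (ω l) →
        (x, l.1 * x + l.2) ∈ B ∧ (y, l.1 * y + l.2) ∈ B ∧ (z, l.1 * z + l.2) ∈ A ∧ x ≠ y ∧
        ω l x + ω l y + ω l z = 0 := by
      intro l x y z h
      simp only [trx, trip, sec, Finset.mem_filter, Finset.mem_product, Finset.mem_univ, true_and] at h
      exact ⟨h.1.1.1, h.1.1.2.1, h.1.1.2.2, h.1.2, h.2⟩
    apply Finset.card_le_card_of_injOn (fun s : (_ : ZMod q × ZMod q) × (ZMod q × ZMod q × ZMod q) =>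
      ((s.2.1, s.1.1 * s.2.1 + s.1.2), (s.2.2.1, s.1.1 * s.2.2.1 + s.1.2)))
    · rintro ⟨l, x, y, z⟩ h
      rw [Finset.mem_coe, Finset.mem_sigma] at h
      obtain ⟨m1, m2, m3, m4, m5⟩ := mem l x y z h.2
      rw [Finset.mem_coe, hX, Finset.mem_filter, Finset.mem_product]
      refine ⟨⟨m1, m2⟩, (z, l.1 * z + l.2), m3, ?_, ?_, ?_, l, rfl, rfl, rfl, m5⟩
      · intro e; exact m4 (Prod.mk.inj e).1
      · intro e
        exact Finset.disjoint_left.mp hd m3 (e ▸ m2)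
      · intro e
        exact Finset.disjoint_left.mp hd m3 (e ▸ m1)
    · rintro ⟨l, x, y, z⟩ h ⟨l', x', y', z'⟩ h' e
      rw [Finset.mem_coe, Finset.mem_sigma] at h h'
      obtain ⟨m1, m2, m3, m4, m5⟩ := mem l x y z h.2
      obtain ⟨m1', m2', m3', m4', m5'⟩ := mem l' x' y' z' h'.2
      simp only [Prod.mk.injEq] at e
      obtain ⟨⟨rfl, e1⟩, rfl, e2⟩ := e
      obtain ⟨r1, r2⟩ := line_unique m4 e1 e2
      have hl : l = l' := Prod.ext r1 r2
      subst hl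
      have : ω l z = ω l z' := by linear_combination m5 - m5'
      have := (ω l).injective this
      subst this
      rfl
  rw [Finset.card_sigma] at hinj
  have hsum : L.card * B.card ^ 2 ≤ 256 * q ^ 2 * X.card := by
    calc L.card * B.card ^ 2 = ∑ l ∈ L, B.card ^ 2 := by rw [Finset.sum_const, smul_eq_mul]
      _ ≤ ∑ l ∈ L, 256 * q ^ 2 * (trx (sec A l) (sec B l) (ω l)).card := Finset.sum_le_sum key
      _ = 256 * q ^ 2 * ∑ l ∈ L, (trx (sec A l) (sec B l) (ω l)).card := by rw [Finset.mul_sum]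
      _ ≤ _ := Nat.mul_le_mul_left _ hinj
  have : q ^ 2 * B.card ^ 2 ≤ q ^ 2 * (512 * X.card) := by
    calc q ^ 2 * B.card ^ 2 ≤ 2 * L.card * B.card ^ 2 := Nat.mul_le_mul_right _ hLc
      _ = 2 * (L.card * B.card ^ 2) := by ring
      _ ≤ 2 * (256 * q ^ 2 * X.card) := Nat.mul_le_mul_left _ hsum
      _ = _ := by ring
  exact Nat.le_of_mul_le_mul_left this (by positivity)

end lines


theorem hasMonoCopy_mono {N N' : ℕ} (h : N ≤ N') {χ : Finset ℕ → Bool} {H : ThreeGraph} {c : Bool}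
    (hc : hasMonoCopy N χ H c) : hasMonoCopy N' χ H c := by
  obtain ⟨φ, h1, h2, h3⟩ := hc
  exact ⟨φ, h1, fun v hv => (h2 v hv).trans_le h, h3⟩

theorem copy_of_clique {N : ℕ} {χ : Finset ℕ → Bool} {H : ThreeGraph} {c : Bool} (S : Finset ℕ)
    (hS : S ⊆ Finset.range N) (hc : S.card = H.verts.card)
    (hm : ∀ e ⊆ S, e.card = 3 → χ e = c) : hasMonoCopy N χ H c := by
  classical
  let g : H.verts ≃ S := Finset.equivOfCardEq hc.symm
  let φ : ℕ → ℕ := fun v => if h : v ∈ H.verts then (g ⟨v, h⟩ : ℕ) else 0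
  have hφ : ∀ v (h : v ∈ H.verts), φ v = (g ⟨v, h⟩ : ℕ) := by
    intro v h; simp only [φ, dif_pos h]
  have hin : ∀ v ∈ H.verts, φ v ∈ S := by
    intro v h; rw [hφ v h]; exact (g ⟨v, h⟩).2
  have hinj : Set.InjOn φ ↑H.verts := by
    intro u hu v hv h
    rw [Finset.mem_coe] at hu hv
    rw [hφ u hu, hφ v hv] at h
    have := g.injective (Subtype.ext h)
    exact congrArg Subtype.val this
  refine ⟨φ, hinj, fun v hv => Finset.mem_range.mp (hS (hin v hv)), ?_⟩
  intro e he
  apply hm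
  · intro x hx
    obtain ⟨v, hv, rfl⟩ := Finset.mem_image.mp hx
    exact hin v (H.subset_verts e he hv)
  · rw [Finset.card_image_of_injOn, H.card_eq e he]
    exact hinj.mono (by exact_mod_cast H.subset_verts e he)

theorem ramsey_gt (G H : ThreeGraph) (M : ℕ) (χ : Finset ℕ → Bool)
    (h1 : ¬ hasMonoCopy M χ G true) (h2 : ¬ hasMonoCopy M χ H false) : M < ramsey G H := by
  by_contra hcon
  push Not at hcon
  have hne : {N : ℕ | ∀ χ : Finset ℕ → Bool,
      hasMonoCopy N χ G true ∨ hasMonoCopy N χ H false}.Nonempty := by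
    obtain ⟨N, hN⟩ := ramsey_fin 3 G.verts.card H.verts.card
    refine ⟨N, fun χ => ?_⟩
    rcases hN (Finset.range N) (by simp) χ with ⟨S, hS, hc, hm⟩ | ⟨S, hS, hc, hm⟩
    · exact Or.inl (copy_of_clique S hS hc hm)
    · exact Or.inr (copy_of_clique S hS hc hm)
  have hmem := Nat.sInf_mem hne
  rcases hmem χ with h | h
  · exact h1 (hasMonoCopy_mono hcon h)
  · exact h2 (hasMonoCopy_mono hcon h)

theorem no_blue {D l n : ℕ} (R : ℕ → ℕ → Prop) (χ : Finset ℕ → Bool)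
    (hχ : ∀ e, χ e = false → ¬ redP R e)
    (hG : ∀ I ⊆ Finset.range (D + 1), I.card = l → ∃ i ∈ I, ∃ j ∈ I, i < j ∧ R i j)
    (hn : (D + 2) ^ l < n) : ¬ hasMonoCopy (2 ^ D) χ (completeTG n) false := by
  classical
  rintro ⟨φ, h1, h2, h3⟩
  simp only [completeTG] at h1 h2 h3
  have hcard : ((Finset.range n).image φ).card = n := by
    rw [Finset.card_image_of_injOn h1, Finset.card_range]
  have := blue_clique_bound R D l hG ((Finset.range n).image φ) (by
    intro x hx
    obtain ⟨v, hv, rfl⟩ := Finset.mem_image.mp hx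
    exact h2 v hv) (by
    intro e he hc
    let e' := (Finset.range n).filter (fun v => φ v ∈ e)
    have hi : e'.image φ = e := by
      ext x
      simp only [e', Finset.mem_image, Finset.mem_filter]
      constructor
      · rintro ⟨v, hv, rfl⟩; exact hv.2
      · intro hx
        obtain ⟨v, hv, rfl⟩ := Finset.mem_image.mp (he hx)
        exact ⟨v, ⟨hv, hx⟩, rfl⟩
    have hc' : e'.card = 3 := by
      rw [← hc, ← hi, Finset.card_image_of_injOn]
      exact h1.mono (by exact_mod_cast Finset.filter_subset _ _)
    apply hχ
    rw [← hi]
    apply h3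
    rw [Finset.mem_powersetCard]
    exact ⟨Finset.filter_subset _ _, hc'⟩)
  omega

theorem edge_pick {P : Type*} (T : P → P → P → Prop)
    (hs1 : ∀ a b c, T a b c → T b a c) (hs2 : ∀ a b c, T a b c → T a c b) (f : P → ℕ)
    {a b c : P} (h : T a b c) {u v : ℕ} (hu : u ∈ ({f a, f b, f c} : Finset ℕ))
    (hv : v ∈ ({f a, f b, f c} : Finset ℕ)) (huv : u ≠ v) :
    ∃ a' b' c', T a' b' c' ∧ f a' = u ∧ f b' = v ∧
      ({f a, f b, f c} : Finset ℕ) = {f a', f b', f c'} := by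
  simp only [Finset.mem_insert, Finset.mem_singleton] at hu hv
  have t1 := hs1 _ _ _ h
  have t2 := hs2 _ _ _ h
  have t3 := hs2 _ _ _ t1
  have t4 := hs1 _ _ _ t2
  have t5 := hs1 _ _ _ t3
  rcases hu with rfl | rfl | rfl <;> rcases hv with rfl | rfl | rfl
  · exact absurd rfl huv
  · exact ⟨a, b, c, h, rfl, rfl, rfl⟩
  · exact ⟨a, c, b, t2, rfl, rfl, by ext; simp; tauto⟩
  · exact ⟨b, a, c, t1, rfl, rfl, by ext; simp; tauto⟩
  · exact absurd rfl huv
  · exact ⟨b, c, a, t3, rfl, rfl, by ext; simp; tauto⟩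
  · exact ⟨c, a, b, t4, rfl, rfl, by ext; simp; tauto⟩
  · exact ⟨c, b, a, t5, rfl, rfl, by ext; simp; tauto⟩
  · exact absurd rfl huv

theorem exists_F (q k : ℕ) [Fact q.Prime] (hq : 2 ^ 30 ≤ q) (hk : q ^ 2 ≤ k) :
    ∃ F : ThreeGraph, F.verts.card = k ∧ LinearTG F ∧
      (∀ D l Q m n : ℕ, 0 < Q →
        ((D : ℝ) + 1) ^ l * (1 - 1 / (Q : ℝ)) ^ (l * (l - 1) / 2) < 1 / 2 →
        (D + 1) * 2 ^ (q ^ 2 + 2) ≤ Q ^ m → (D + 2) ^ l < n →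
        8 * 512 * 2 ^ 14 * (2 * m) < q → 2 ^ D < ramsey F (completeTG n)) ∧
      (∀ n : ℕ, 3 ≤ n → 1 < ramsey F (completeTG n)) := by
  classical
  obtain ⟨T, hs1, hs2, hne, hlin, hT⟩ := exists_T (q := q) hq
  have hcardP : Fintype.card (ZMod q × ZMod q) = q ^ 2 := by
    rw [Fintype.card_prod, ZMod.card, sq]
  let g : ZMod q × ZMod q ≃ Fin (q ^ 2) := Fintype.equivFinOfCardEq hcardP
  let f : ZMod q × ZMod q → ℕ := fun p => (g p : ℕ)
  have hf : Function.Injective f := fun a b h => g.injective (Fin.ext h)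
  have hfk : ∀ p, f p ∈ Finset.range k := fun p => Finset.mem_range.mpr ((g p).2.trans_le hk)
  let F : ThreeGraph := {
    verts := Finset.range k
    edges := ((Finset.range k).powersetCard 3).filter
      (fun s => ∃ a b c, T a b c ∧ s = ({f a, f b, f c} : Finset ℕ))
    card_eq := fun e he => (Finset.mem_powersetCard.mp (Finset.mem_filter.mp he).1).2
    subset_verts := fun e he => (Finset.mem_powersetCard.mp (Finset.mem_filter.mp he).1).1 }
  have hedge : ∀ a b c, T a b c → ({f a, f b, f c} : Finset ℕ) ∈ F.edges := by
    intro a b c h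
    have n1 := hne _ _ _ h
    have n2 := hne _ _ _ (hs2 _ _ _ h)
    have n3 := hne _ _ _ (hs2 _ _ _ (hs1 _ _ _ h))
    rw [Finset.mem_filter, Finset.mem_powersetCard]
    refine ⟨⟨?_, ?_⟩, a, b, c, h, rfl⟩
    · intro x hx
      simp only [Finset.mem_insert, Finset.mem_singleton] at hx
      rcases hx with rfl | rfl | rfl <;> exact hfk _
    · rw [Finset.card_eq_three]
      exact ⟨_, _, _, hf.ne n1, hf.ne n2, hf.ne n3, rfl⟩
  refine ⟨F, Finset.card_range k, ?_, ?_, ?_⟩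
  · intro e₁ h1 e₂ h2 hne12
    by_contra hcon
    push Not at hcon
    obtain ⟨u, hu, v, hv, huv⟩ := Finset.one_lt_card.mp hcon
    rw [Finset.mem_inter] at hu hv
    obtain ⟨a, b, c, t, rfl⟩ := (Finset.mem_filter.mp h1).2
    obtain ⟨a', b', c', t', rfl⟩ := (Finset.mem_filter.mp h2).2
    obtain ⟨x, y, z, r, rx, ry, e1⟩ := edge_pick T hs1 hs2 f t hu.1 hv.1 huv
    obtain ⟨x', y', z', r', rx', ry', e2⟩ := edge_pick T hs1 hs2 f t' hu.2 hv.2 huv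
    have hx : x = x' := hf (rx.trans rx'.symm)
    have hy : y = y' := hf (ry.trans ry'.symm)
    subst hx hy
    have hz := hlin _ _ _ _ r r'
    subst hz
    exact hne12 (e1.trans e2.symm)
  · intro D l Q m n hQ c1 c2 c3 c4
    obtain ⟨R, hsymm, hirr, hR1, hR2⟩ := exists_G D l Q (q ^ 2) m hQ c1 c2
    apply ramsey_gt F (completeTG n) (2 ^ D) (fun e => decide (redP R e))
    · rintro ⟨φ, p1, p2, p3⟩
      have := no_red_copy (P := ZMod q × ZMod q) q (2 ^ 14) 512 (2 * m) D (by omega) (by norm_num)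
        (by omega) hcardP T hs1 hs2 hne hT (fun p => φ (f p))
        (by
          intro a b h
          exact hf (p1 (hfk a) (hfk b) h))
        (fun p => p2 _ (hfk p)) R hsymm hirr hR2
        (by
          intro a b c t hab hbc
          have h := p3 _ (hedge a b c t)
          rw [decide_eq_true_eq, Finset.image_insert, Finset.image_insert,
            Finset.image_singleton] at h
          exact (redP_iff hab hbc).mp h)
      omega
    · apply no_blue R _ _ hR1 c3
      intro e he
      simpa using he
  · intro n hn
    have hk1 : 1 < k := by nlinarith
    apply ramsey_gt F (completeTG n) 1 (fun _ => true)
    · rintro ⟨φ, p1, p2, -⟩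
      have a0 : (0 : ℕ) ∈ F.verts := Finset.mem_range.mpr (by omega)
      have a1 : (1 : ℕ) ∈ F.verts := Finset.mem_range.mpr (by omega)
      have := p1 a0 a1 (by have := p2 0 a0; have := p2 1 a1; omega)
      omega
    · rintro ⟨φ, p1, p2, -⟩
      have a0 : (0 : ℕ) ∈ (completeTG n).verts := Finset.mem_range.mpr (by omega)
      have a1 : (1 : ℕ) ∈ (completeTG n).verts := Finset.mem_range.mpr (by omega)
      have := p1 a0 a1 (by have := p2 0 a0; have := p2 1 a1; omega)
      omega


theorem params_x (α : ℝ) (hα : 0 ≤ α) (s m n : ℕ) (hm : 2 * α + 4 ≤ m) (x u : ℝ)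
    (hx : x = Real.log n) (hn : 0 < n) (hu : u = x ^ (1 / 4 : ℝ)) (h1 : 100 ≤ x) (h2 : (2 : ℝ) ^ (s + 2) ≤ x)
    (h3 : (α + 1) * Real.log x + 1 ≤ u / 8) :
    ∃ D l Q : ℕ, 0 < Q ∧
      ((D : ℝ) + 1) ^ l * (1 - 1 / (Q : ℝ)) ^ (l * (l - 1) / 2) < 1 / 2 ∧
      (D + 1) * 2 ^ (s + 2) ≤ Q ^ m ∧ (D + 2) ^ l < n ∧ x ^ α ≤ D := by
  have hx0 : 0 < x := by linarith
  have hL : 0 ≤ Real.log x := Real.log_nonneg (by linarith)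
  have hu8 : 8 ≤ u := by nlinarith
  have hu4 : u ^ 4 = x := by
    rw [hu, ← Real.rpow_natCast, ← Real.rpow_mul hx0.le]; norm_num
  have hu2 : u ^ 2 = x ^ (1 / 2 : ℝ) := by
    rw [hu, ← Real.rpow_natCast, ← Real.rpow_mul hx0.le]; norm_num
  have hxa : 1 ≤ x ^ α := Real.one_le_rpow (by linarith) hα
  have hxa1 : x ^ (α + 1) = x ^ α * x := by rw [Real.rpow_add hx0, Real.rpow_one]
  obtain ⟨D, hD⟩ : ∃ D : ℕ, D = ⌈x ^ α⌉₊ := ⟨_, rfl⟩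
  obtain ⟨Q, hQ⟩ : ∃ Q : ℕ, Q = ⌈u ^ 2⌉₊ := ⟨_, rfl⟩
  obtain ⟨l, hl⟩ : ∃ l : ℕ, l = ⌊u ^ 3⌋₊ := ⟨_, rfl⟩
  have hD1 : x ^ α ≤ D := by rw [hD]; exact Nat.le_ceil _
  have hD2 : (D : ℝ) < x ^ α + 1 := by rw [hD]; exact Nat.ceil_lt_add_one (by positivity)
  have hQ1 : u ^ 2 ≤ Q := by rw [hQ]; exact Nat.le_ceil _
  have hQ2 : (Q : ℝ) < u ^ 2 + 1 := by rw [hQ]; exact Nat.ceil_lt_add_one (by positivity)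
  have hl1 : (l : ℝ) ≤ u ^ 3 := by rw [hl]; exact Nat.floor_le (by positivity)
  have hl2 : u ^ 3 < l + 1 := by rw [hl]; exact Nat.lt_floor_add_one _
  have hu3 : 512 ≤ u ^ 3 := by
    have : (8 : ℝ) ^ 3 ≤ u ^ 3 := by gcongr
    norm_num at this; exact this
  have hl3 : (1 : ℝ) ≤ l := by linarith
  have hlN : 1 ≤ l := by exact_mod_cast hl3
  have hQpos : (0 : ℝ) < Q := by nlinarith
  have hQ64 : (64 : ℝ) ≤ Q := by nlinarith
  have hDx : (D : ℝ) + 2 ≤ x ^ (α + 1) := by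
    rw [hxa1]; nlinarith
  have hlog : Real.log (D + 2) ≤ u / 8 - 1 := by
    have := Real.log_le_log (by positivity) hDx
    rw [Real.log_rpow hx0] at this
    linarith
  refine ⟨D, l, Q, by exact_mod_cast hQpos, ?_, ?_, ?_, hD1⟩
  · obtain ⟨j, hj⟩ : ∃ j, j = l * (l - 1) / 2 := ⟨_, rfl⟩
    rw [← hj]
    have hj2 : 2 * j = l * (l - 1) := by
      rw [hj]; exact Nat.mul_div_cancel' (Nat.even_mul_pred_self l).two_dvd
    have hj3 : 2 * (j : ℝ) = l * (l - 1) := by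
      have : ((2 * j : ℕ) : ℝ) = ((l * (l - 1) : ℕ) : ℝ) := by rw [hj2]
      push_cast [Nat.cast_sub hlN] at this
      exact this
    have e1 : ((D : ℝ) + 1) ^ l ≤ Real.exp (l * (u / 8 - 1)) := by
      rw [Real.exp_nat_mul]
      gcongr
      have hle : (D : ℝ) + 1 ≤ D + 2 := by linarith
      refine hle.trans ?_
      rw [← Real.log_le_iff_le_exp (by positivity)]
      exact hlog
    have e2 : (1 - 1 / (Q : ℝ)) ^ j ≤ Real.exp (j * (-(1 / Q))) := by
      rw [Real.exp_nat_mul]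
      have : 1 / (Q : ℝ) ≤ 1 := by rw [div_le_one hQpos]; linarith
      apply pow_le_pow_left₀ (by linarith)
      have := Real.add_one_le_exp (-(1 / (Q : ℝ)))
      linarith
    have e3 : (l : ℝ) * (u / 8) ≤ j * (1 / Q) := by
      rw [mul_one_div, le_div_iff₀ hQpos]
      have : (l : ℝ) * (u * Q / 4) ≤ l * (l - 1) := by
        apply mul_le_mul_of_nonneg_left _ (by positivity)
        nlinarith
      nlinarith
    have hQle : 1 / (Q : ℝ) ≤ 1 := by rw [div_le_one hQpos]; linarith
    calc ((D : ℝ) + 1) ^ l * (1 - 1 / (Q : ℝ)) ^ j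
        ≤ Real.exp (l * (u / 8 - 1)) * Real.exp (j * (-(1 / Q))) :=
          mul_le_mul e1 e2 (pow_nonneg (by linarith) _) (Real.exp_pos _).le
      _ = Real.exp (l * (u / 8 - 1) + j * (-(1 / Q))) := by rw [Real.exp_add]
      _ ≤ Real.exp (-1) := by
          apply Real.exp_le_exp.mpr
          linarith
      _ < 1 / 2 := by
          rw [Real.exp_neg, inv_eq_one_div]
          apply one_div_lt_one_div_of_lt (by norm_num)
          have := Real.exp_one_gt_d9
          linarith
  · have : ((D : ℝ) + 1) * 2 ^ (s + 2) ≤ (Q : ℝ) ^ m := by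
      calc ((D : ℝ) + 1) * 2 ^ (s + 2) ≤ x ^ (α + 1) * x := by
            apply mul_le_mul _ h2 (by positivity) (by positivity)
            linarith
        _ = x ^ (α + 2) := by
            rw [show α + 2 = (α + 1) + 1 by ring, Real.rpow_add hx0 (α + 1), Real.rpow_one]
        _ ≤ x ^ ((1 / 2 : ℝ) * m) := by
            apply Real.rpow_le_rpow_of_exponent_le (by linarith)
            linarith
        _ = (u ^ 2) ^ m := by
            rw [Real.rpow_mul hx0.le, Real.rpow_natCast, hu2]
        _ ≤ (Q : ℝ) ^ m := by gcongr
    exact_mod_cast this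
  · have : ((D : ℝ) + 2) ^ l < n := by
      have hexp : Real.exp x = n := by
        rw [hx, Real.exp_log (by exact_mod_cast hn)]
      rw [← hexp]
      calc ((D : ℝ) + 2) ^ l ≤ Real.exp (l * (u / 8 - 1)) := by
            rw [Real.exp_nat_mul]
            gcongr
            rw [← Real.log_le_iff_le_exp (by positivity)]
            exact hlog
        _ < Real.exp x := by
            apply Real.exp_lt_exp.mpr
            calc (l : ℝ) * (u / 8 - 1) ≤ u ^ 3 * (u / 8 - 1) := by
                  apply mul_le_mul_of_nonneg_right hl1; linarith
              _ < u ^ 4 := by nlinarith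
              _ = x := hu4
    exact_mod_cast this

theorem params (α : ℝ) (hα : 0 ≤ α) (s m : ℕ) (hm : 2 * α + 4 ≤ m) :
    ∃ n0 : ℕ, ∀ n : ℕ, n0 ≤ n → ∃ D l Q : ℕ, 0 < Q ∧
      ((D : ℝ) + 1) ^ l * (1 - 1 / (Q : ℝ)) ^ (l * (l - 1) / 2) < 1 / 2 ∧
      (D + 1) * 2 ^ (s + 2) ≤ Q ^ m ∧ (D + 2) ^ l < n ∧ Real.log n ^ α ≤ D := by
  have e3 : ∀ᶠ x : ℝ in Filter.atTop, (α + 1) * Real.log x + 1 ≤ x ^ (1 / 4 : ℝ) / 8 := by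
    have h1 := (isLittleO_log_rpow_atTop (r := 1 / 4) (by norm_num)).bound
      (c := 1 / (16 * (α + 1))) (by positivity)
    have h2 := (tendsto_rpow_atTop (y := 1 / 4) (by norm_num)).eventually_ge_atTop 16
    filter_upwards [h1, h2, Filter.eventually_ge_atTop 1] with x a1 a2 a3
    rw [Real.norm_of_nonneg (Real.log_nonneg a3), Real.norm_of_nonneg (by positivity)] at a1
    have : (α + 1) * Real.log x ≤ (α + 1) * (1 / (16 * (α + 1)) * x ^ (1 / 4 : ℝ)) :=
      mul_le_mul_of_nonneg_left a1 (by positivity)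
    have e : (α + 1) * (1 / (16 * (α + 1)) * x ^ (1 / 4 : ℝ)) = x ^ (1 / 4 : ℝ) / 16 := by
      field_simp
    linarith
  have ev := (e3.and ((Filter.eventually_ge_atTop (100 : ℝ)).and
    (Filter.eventually_ge_atTop ((2 : ℝ) ^ (s + 2)))))
  have ht : Filter.Tendsto (fun n : ℕ => Real.log (n : ℝ)) Filter.atTop Filter.atTop :=
    Real.tendsto_log_atTop.comp tendsto_natCast_atTop_atTop
  obtain ⟨n0, hn0⟩ := Filter.eventually_atTop.mp ((ht.eventually ev).and (Filter.eventually_gt_atTop 0))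
  refine ⟨n0, fun n hn => ?_⟩
  obtain ⟨⟨a1, a2, a3⟩, a4⟩ := hn0 n hn
  exact params_x α hα s m n hm (Real.log n) _ rfl a4 rfl a2 a3 a1

/-- For all sufficiently large `k` there is a linear 3-graph `F` on `k`
vertices with `r(F, K_n^{(3)}) > 2^{c (log n)^{√k/(128 (log k)^5)}}` for all `n ≥ 3`,
where `c > 0` depends only on `k`. -/
theorem linear_ramsey_superpolynomial :
    ∃ k₀ : ℕ, ∀ k : ℕ, k₀ ≤ k →
      ∃ F : ThreeGraph, F.verts.card = k ∧ LinearTG F ∧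
        ∃ c : ℝ, c > 0 ∧ ∀ n : ℕ, 3 ≤ n →
          (ramsey F (completeTG n) : ℝ) >
            (2 : ℝ) ^ (c * Real.log n ^ (Real.sqrt k / (128 * Real.log k ^ 5))) := by
  refine ⟨2 ^ 64, fun k hk => ?_⟩
  have hkR : (2 : ℝ) ^ 64 ≤ k := by exact_mod_cast hk
  have hsq : (2 : ℝ) ^ 32 ≤ Real.sqrt k := by
    apply Real.le_sqrt_of_sq_le
    rw [← pow_mul]; exact hkR
  have hlogk : (32 : ℝ) ≤ Real.log k := by
    have h1 : Real.log ((2 : ℝ) ^ 64) ≤ Real.log k := Real.log_le_log (by positivity) hkR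
    rw [Real.log_pow] at h1
    have := Real.log_two_gt_d9
    push_cast at h1
    linarith
  set α : ℝ := Real.sqrt k / (128 * Real.log k ^ 5) with hα
  have hlog5 : (2 : ℝ) ^ 25 ≤ Real.log k ^ 5 := by
    calc (2 : ℝ) ^ 25 = 32 ^ 5 := by norm_num
      _ ≤ Real.log k ^ 5 := by gcongr
  have hα0 : 0 ≤ α := by rw [hα]; positivity
  have hα1 : α * 2 ^ 32 ≤ Real.sqrt k := by
    rw [hα, div_mul_eq_mul_div, div_le_iff₀ (by positivity)]
    apply mul_le_mul_of_nonneg_left _ (Real.sqrt_nonneg _)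
    norm_num at hlog5 ⊢
    linarith
  -- the prime
  have hs32 : 2 ^ 32 ≤ Nat.sqrt k := by
    rw [Nat.le_sqrt']
    rw [← pow_mul]; exact hk
  obtain ⟨q, hqp, hq1, hq2⟩ := Nat.exists_prime_lt_and_le_two_mul (Nat.sqrt k / 2) (by omega)
  have hqk : q ^ 2 ≤ k := by
    rw [← Nat.le_sqrt']; omega
  have hq31 : 2 ^ 30 ≤ q := by omega
  have hqs : Real.sqrt k < 2 * q := by
    have h1 : Nat.sqrt k + 1 ≤ 2 * q := by omega
    have h2 : k < (Nat.sqrt k + 1) ^ 2 := Nat.lt_succ_sqrt' k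
    have h3 : k < (2 * q) ^ 2 := h2.trans_le (Nat.pow_le_pow_left h1 2)
    rw [Real.sqrt_lt' (by positivity)]
    exact_mod_cast h3
  have : Fact q.Prime := ⟨hqp⟩
  obtain ⟨F, hF1, hF2, hF3, hF4⟩ := exists_F q k hq31 hqk
  refine ⟨F, hF1, hF2, ?_⟩
  obtain ⟨m, hm⟩ : ∃ m : ℕ, m = ⌈2 * α + 4⌉₊ := ⟨_, rfl⟩
  have hm1 : 2 * α + 4 ≤ m := by rw [hm]; exact Nat.le_ceil _
  have hm2 : (m : ℝ) < 2 * α + 4 + 1 := by rw [hm]; exact Nat.ceil_lt_add_one (by positivity)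
  have hmq : 8 * 512 * 2 ^ 14 * (2 * m) < q := by
    have : (8 * 512 * 2 ^ 14 * (2 * m) : ℝ) < q := by
      norm_num at hα1 hsq ⊢
      linarith
    exact_mod_cast this
  obtain ⟨n0, hn0⟩ := params α hα0 (q ^ 2) m hm1
  set Y : ℝ := Real.log ((n0 + 3 : ℕ) : ℝ) ^ α with hY
  have hY0 : 0 ≤ Y := by
    rw [hY]; exact Real.rpow_nonneg (Real.log_natCast_nonneg _) _
  refine ⟨1 / (1 + Y), by positivity, fun n hn => ?_⟩
  have hX0 : 0 ≤ Real.log n ^ α := Real.rpow_nonneg (Real.log_natCast_nonneg _) _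
  have hc1 : 1 / (1 + Y) ≤ 1 := by rw [div_le_one (by positivity)]; linarith
  by_cases hcase : n0 ≤ n
  · obtain ⟨D, l, Q, p1, p2, p3, p4, p5⟩ := hn0 n hcase
    have := hF3 D l Q m n p1 p2 p3 p4 hmq
    have hR : (2 : ℝ) ^ D < ramsey F (completeTG n) := by exact_mod_cast this
    refine lt_of_le_of_lt ?_ hR
    rw [← Real.rpow_natCast]
    apply Real.rpow_le_rpow_of_exponent_le (by norm_num)
    nlinarith
  · have := hF4 n hn
    have hR : (2 : ℝ) ≤ ramsey F (completeTG n) := by exact_mod_cast this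
    refine lt_of_lt_of_le ?_ hR
    have hle : Real.log n ^ α ≤ Y := by
      rw [hY]
      apply Real.rpow_le_rpow (Real.log_natCast_nonneg _) _ hα0
      apply Real.log_le_log
      · exact_mod_cast (by omega : 0 < n)
      · exact_mod_cast (by omega : n ≤ n0 + 3)
    have hlt : 1 / (1 + Y) * Real.log n ^ α < 1 := by
      rw [one_div_mul_eq_div, div_lt_one (by positivity)]
      linarith
    calc (2 : ℝ) ^ (1 / (1 + Y) * Real.log n ^ α) < (2 : ℝ) ^ (1 : ℝ) :=
          Real.rpow_lt_rpow_of_exponent_lt (by norm_num) hlt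
      _ = 2 := Real.rpow_one 2
end

section
/- For every sufficiently small ε > 0 there exists n_0 such that the following holds for all integers n ≥ n_0. Let t = ⌊n^ε⌋ and let g : [t]^3 → {red, blue} be any function such that for all X, Y, Z ⊆ [t] with |X|, |Y|, |Z| ≥ t^{1−ε} there exists (x,y,z) ∈ X × Y × Z with g(x,y,z) = red. Then the number of triples of functions (a, b, c), each mapping [n] × [n] to [t], such that g(a(i,j), b(j,k), c(i,k)) = blue for all (i,j,k) ∈ [n]^3, is at most t^{(3 − ε/50) n^2}. -/
section CountBlue
open Finset

/-- position of `x` in `S` -/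
def cbIdx (S : Finset ℕ) (x : ℕ) : ℕ := #{y ∈ S | y < x}

lemma cbIdx_lt {S : Finset ℕ} {x : ℕ} (hx : x ∈ S) : cbIdx S x < #S := by
  apply Finset.card_lt_card
  rw [Finset.filter_ssubset]
  exact ⟨x, hx, lt_irrefl x⟩

lemma cbIdx_strict {S : Finset ℕ} {x y : ℕ} (hx : x ∈ S) (h : x < y) :
    cbIdx S x < cbIdx S y := by
  apply Finset.card_lt_card
  rw [Finset.ssubset_iff_of_subset]
  · exact ⟨x, by simp [hx, h], by simp⟩
  · intro z; simp only [mem_filter]; rintro ⟨h1, h2⟩; exact ⟨h1, h2.trans h⟩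

lemma cbIdx_inj {S : Finset ℕ} {x y : ℕ} (hx : x ∈ S) (hy : y ∈ S)
    (h : cbIdx S x = cbIdx S y) : x = y := by
  rcases lt_trichotomy x y with h' | h' | h'
  · exact absurd h (cbIdx_strict hx h').ne
  · exact h'
  · exact absurd h (cbIdx_strict hy h').ne'

/-- Encoding lemma: each coordinate of `f` is revealed in order of rank. -/
lemma cb_enc {ι : Type*} [Fintype ι] [DecidableEq ι] (r : ι → ℕ)
    (S : ι → (ι → ℕ) → Finset ℕ)
    (hS : ∀ e f f', (∀ e', r e' < r e → f e' = f' e') → S e f = S e f')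
    (t s m : ℕ) (P : Set (ι → ℕ))
    (hP : ∀ f ∈ P, (∀ e, f e ∈ Finset.Icc 1 t) ∧
      m ≤ #{e : ι | f e ∈ S e f ∧ #(S e f) ≤ s}) :
    P.ncard ≤ 2 ^ Fintype.card ι * (s ^ m * t ^ (Fintype.card ι - m)) := by
  classical
  let Q : Finset ι → Set (ι → ℕ) := fun G =>
    {f | (∀ e, f e ∈ Finset.Icc 1 t) ∧ ∀ e ∈ G, f e ∈ S e f ∧ #(S e f) ≤ s}
  have hfin : ∀ G, (Q G).Finite := by
    intro G
    apply Set.Finite.subset (Finset.finite_toSet (Fintype.piFinset fun _ : ι => Finset.Icc 1 t))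
    intro f hf
    simpa only [Finset.mem_coe, Fintype.mem_piFinset] using hf.1
  have hQ : ∀ G ∈ powersetCard m (univ : Finset ι),
      (Q G).ncard ≤ s ^ m * t ^ (Fintype.card ι - m) := by
    intro G hG
    have hGm : #G = m := (mem_powersetCard.1 hG).2
    let T : Finset (ι → ℕ) := Fintype.piFinset fun e => if e ∈ G then range s else Icc 1 t
    have hT : #T = s ^ m * t ^ (Fintype.card ι - m) := by
      simp only [T, Fintype.card_piFinset]
      rw [← hGm]
      have : ∀ e : ι, #(if e ∈ G then range s else Icc 1 t) = if e ∈ G then s else t := by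
        intro e; split_ifs <;> simp
      simp only [this]
      rw [Finset.prod_ite]
      simp only [prod_const]
      congr 2
      · congr 1; ext; simp
      · rw [← Finset.card_compl]; congr 1; ext; simp
    rw [← hT, ← Set.ncard_coe_finset]
    apply Set.ncard_le_ncard_of_injOn (fun f e => if e ∈ G then cbIdx (S e f) (f e) else f e)
    · intro f hf
      simp only [T, Finset.mem_coe, Fintype.mem_piFinset]
      intro e
      split_ifs with he
      · exact mem_range.2 ((cbIdx_lt (hf.2 e he).1).trans_le (hf.2 e he).2)
      · exact hf.1 e
    · intro f hf f' hf' hff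
      have key : ∀ k, ∀ e, r e = k → f e = f' e := by
        intro k
        induction k using Nat.strong_induction_on with
        | _ k ih =>
          intro e he
          have hs : S e f = S e f' := hS e f f' (fun e' he' => ih (r e') (he ▸ he') e' rfl)
          have h1 := congrFun hff e
          by_cases heG : e ∈ G
          · simp only [heG, if_true] at h1
            rw [← hs] at h1
            exact cbIdx_inj (hf.2 e heG).1 (hs ▸ (hf'.2 e heG).1) h1
          · simpa only [heG, if_false] using h1
      funext e
      exact key _ e rfl
  have hsub : P ⊆ ⋃ G ∈ powersetCard m (univ : Finset ι), Q G := by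
    intro f hf
    obtain ⟨h1, h2⟩ := hP f hf
    obtain ⟨G, hG, hGc⟩ := Finset.exists_subset_card_eq h2
    simp only [Set.mem_iUnion]
    refine ⟨G, mem_powersetCard.2 ⟨subset_univ _, hGc⟩, h1, fun e he => ?_⟩
    simpa using hG he
  calc P.ncard ≤ (⋃ G ∈ powersetCard m (univ : Finset ι), Q G).ncard :=
        Set.ncard_le_ncard hsub (Set.Finite.biUnion (Finset.finite_toSet _) fun G _ => hfin G)
    _ ≤ ∑ G ∈ powersetCard m (univ : Finset ι), (Q G).ncard :=
        Finset.set_ncard_biUnion_le _ _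
    _ ≤ ∑ G ∈ powersetCard m (univ : Finset ι), s ^ m * t ^ (Fintype.card ι - m) :=
        Finset.sum_le_sum hQ
    _ ≤ _ := by
        rw [Finset.sum_const, smul_eq_mul]
        apply Nat.mul_le_mul_right
        rw [card_powersetCard, card_univ]
        exact Nat.choose_le_two_pow _ _

lemma cb_fib {α β : Type*} [Fintype α] [Fintype β] (R : α → β → Prop)
    [∀ a b, Decidable (R a b)] :
    #{p : α × β | R p.1 p.2} = ∑ a, #{b : β | R a b} := by
  simp only [Finset.card_filter, Fintype.sum_prod_type]

lemma cb_fib' {α β : Type*} [Fintype α] [Fintype β] (R : α → β → Prop)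
    [∀ a b, Decidable (R a b)] :
    #{p : α × β | R p.1 p.2} = ∑ b, #{a : α | R a b} := by
  simp only [Finset.card_filter, Fintype.sum_prod_type_right]

lemma cb_markov {α : Type*} (S : Finset α) (f : α → ℕ) (θ : ℕ) :
    #{a ∈ S | θ ≤ f a} * θ ≤ ∑ a ∈ S, f a := by
  calc #{a ∈ S | θ ≤ f a} * θ ≤ ∑ a ∈ S with θ ≤ f a, f a := by
        rw [← smul_eq_mul]
        exact Finset.card_nsmul_le_sum _ _ _ (fun a ha => (mem_filter.1 ha).2)
    _ ≤ _ := Finset.sum_le_sum_of_subset (filter_subset _ _)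

variable {n : ℕ}

/-- some element of the list `A i j` makes a red triple with `y, z` -/
def cbV (g : ℕ × ℕ × ℕ → Bool) (A : Fin n → Fin n → Finset ℕ) (i j : Fin n) (y z : ℕ) : Prop :=
  ∃ x ∈ A i j, g (x, y, z) = true

instance (g : ℕ × ℕ × ℕ → Bool) (A : Fin n → Fin n → Finset ℕ) (i j : Fin n) (y z : ℕ) :
    Decidable (cbV g A i j y z) := by unfold cbV; infer_instance

def cbD (g : ℕ × ℕ × ℕ → Bool) (A : Fin n → Fin n → Finset ℕ) (β : Fin n → ℕ)
    (i : Fin n) (m : ℕ) (z : ℕ) : ℕ :=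
  #{j : Fin n | (j : ℕ) < m ∧ cbV g A i j (β j) z}

def cbC (t : ℕ) (g : ℕ × ℕ × ℕ → Bool) (A : Fin n → Fin n → Finset ℕ) (β : Fin n → ℕ)
    (i : Fin n) (m : ℕ) : Finset ℕ :=
  {z ∈ Finset.Icc 1 t | cbD g A β i m z ≤ 200 * t}

def cbW (t : ℕ) (g : ℕ × ℕ × ℕ → Bool) (A : Fin n → Fin n → Finset ℕ) (β : Fin n → ℕ)
    (j : Fin n) (y : ℕ) : ℕ :=
  ∑ i : Fin n, #{z ∈ Finset.Icc 1 t | z ∈ cbC t g A β i j ∧ cbV g A i j y z}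

def cbY (t : ℕ) (g : ℕ × ℕ × ℕ → Bool) (A : Fin n → Fin n → Finset ℕ) (β : Fin n → ℕ)
    (j : Fin n) : Finset ℕ :=
  {y ∈ Finset.Icc 1 t | cbW t g A β j y ≤ 5 * t * (200 * t + 1)}

lemma cbD_congr (g : ℕ × ℕ × ℕ → Bool) (A : Fin n → Fin n → Finset ℕ) (β β' : Fin n → ℕ)
    (i : Fin n) (m : ℕ) (z : ℕ) (h : ∀ j : Fin n, (j : ℕ) < m → β j = β' j) :
    cbD g A β i m z = cbD g A β' i m z := by
  unfold cbD
  congr 1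
  apply Finset.filter_congr
  intro j _
  constructor
  · rintro ⟨h1, h2⟩; exact ⟨h1, h j h1 ▸ h2⟩
  · rintro ⟨h1, h2⟩; exact ⟨h1, (h j h1).symm ▸ h2⟩

lemma cbC_congr (t : ℕ) (g : ℕ × ℕ × ℕ → Bool) (A : Fin n → Fin n → Finset ℕ) (β β' : Fin n → ℕ)
    (i : Fin n) (m : ℕ) (h : ∀ j : Fin n, (j : ℕ) < m → β j = β' j) :
    cbC t g A β i m = cbC t g A β' i m := by
  unfold cbC
  simp only [cbD_congr g A β β' i m _ h]

lemma cbY_congr (t : ℕ) (g : ℕ × ℕ × ℕ → Bool) (A : Fin n → Fin n → Finset ℕ) (β β' : Fin n → ℕ)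
    (j : Fin n) (h : ∀ l : Fin n, l < j → β l = β' l) :
    cbY t g A β j = cbY t g A β' j := by
  unfold cbY cbW
  simp only [cbC_congr t g A β β' _ (j : ℕ) h]

lemma cbD_mono (g : ℕ × ℕ × ℕ → Bool) (A : Fin n → Fin n → Finset ℕ) (β : Fin n → ℕ)
    (i : Fin n) {m m' : ℕ} (z : ℕ) (h : m ≤ m') : cbD g A β i m z ≤ cbD g A β i m' z := by
  apply Finset.card_le_card
  intro j
  simp only [mem_filter]
  rintro ⟨h1, h2, h3⟩
  exact ⟨h1, by omega, h3⟩

/-- number of steps with a violation while the counter is at most `θ` -/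
lemma cbD_count (g : ℕ × ℕ × ℕ → Bool) (A : Fin n → Fin n → Finset ℕ) (β : Fin n → ℕ)
    (i : Fin n) (z θ : ℕ) :
    #{j : Fin n | cbD g A β i j z ≤ θ ∧ cbV g A i j (β j) z} ≤ θ + 1 := by
  rw [← Finset.card_range (θ + 1)]
  apply Finset.card_le_card_of_injOn (fun j : Fin n => cbD g A β i j z)
  · intro j hj
    simp only [coe_filter, mem_univ, true_and, Set.mem_ofPred_eq] at hj
    simp only [coe_range, Set.mem_Iio]
    omega
  · have key : ∀ j j' : Fin n, cbV g A i j (β j) z → j < j' →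
        cbD g A β i j z < cbD g A β i j' z := by
      intro j j' hv hjj
      apply Finset.card_lt_card
      rw [Finset.ssubset_iff_of_subset]
      · exact ⟨j, by simp [hv, hjj], by simp⟩
      · intro l
        simp only [mem_filter]
        rintro ⟨h1, h2, h3⟩
        exact ⟨h1, h2.trans hjj, h3⟩
    intro j hj j' hj' h
    simp only [coe_filter, mem_univ, true_and, Set.mem_ofPred_eq] at hj hj'
    rcases lt_trichotomy j j' with h' | h' | h'
    · exact absurd h (key _ _ hj.2 h').ne
    · exact h'
    · exact absurd h (key _ _ hj'.2 h').ne'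

lemma cb_step (t s : ℕ) (g : ℕ × ℕ × ℕ → Bool) (ht : 1 ≤ t) (hn : 3000 * t ^ 3 ≤ n)
    (hred : ∀ X Y Z : Finset ℕ, X ⊆ Finset.Icc 1 t → Y ⊆ Finset.Icc 1 t → Z ⊆ Finset.Icc 1 t →
      s < #X → s < #Y → s < #Z → ∃ x ∈ X, ∃ y ∈ Y, ∃ z ∈ Z, g (x, y, z) = true)
    (A : Fin n → Fin n → Finset ℕ) (hA : ∀ i j, A i j ⊆ Finset.Icc 1 t)
    (β γ : Fin n → ℕ) (hβ : ∀ j, β j ∈ Finset.Icc 1 t) (hγ : ∀ i, γ i ∈ Finset.Icc 1 t)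
    (hR : #{p : Fin n × Fin n | cbV g A p.1 p.2 (β p.2) (γ p.1)} ≤ 10 * n * t)
    (hSA : 10 * #{p : Fin n × Fin n | #(A p.1 p.2) ≤ s} ≤ n ^ 2) :
    n ≤ 20 * (#{i : Fin n | γ i ∈ cbC t g A β i n ∧ #(cbC t g A β i n) ≤ s} +
      #{j : Fin n | β j ∈ cbY t g A β j ∧ #(cbY t g A β j) ≤ s}) := by
  have hn0 : 0 < n := by
    have : 0 < t ^ 3 := by positivity
    omega
  -- exceptional `i`
  have hu : 20 * #{i : Fin n | γ i ∉ cbC t g A β i n} ≤ n := by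
    have h1 : ∑ i, cbD g A β i n (γ i) ≤ 10 * n * t := by
      refine le_trans (le_of_eq ?_) hR
      rw [cb_fib (fun i j => cbV g A i j (β j) (γ i))]
      simp [cbD]
    have h2 := cb_markov univ (fun i => cbD g A β i n (γ i)) (200 * t)
    have h3 : #{i : Fin n | γ i ∉ cbC t g A β i n} ≤
        #{i : Fin n | 200 * t ≤ cbD g A β i n (γ i)} := by
      apply Finset.card_le_card
      intro i
      simp only [cbC, mem_filter, hγ i, mem_univ, true_and]
      intro h; omega
    have h4 : #{i : Fin n | γ i ∉ cbC t g A β i n} * (200 * t) ≤ 10 * n * t :=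
      (Nat.mul_le_mul_right _ h3).trans (h2.trans h1)
    have h5 : (20 * #{i : Fin n | γ i ∉ cbC t g A β i n}) * (10 * t) ≤ n * (10 * t) := by
      linarith
    exact Nat.le_of_mul_le_mul_right h5 (by omega)
  by_cases hSC : n ≤ 10 * #{i : Fin n | #(cbC t g A β i n) ≤ s}
  · have : #{i : Fin n | #(cbC t g A β i n) ≤ s} ≤
        #{i : Fin n | γ i ∈ cbC t g A β i n ∧ #(cbC t g A β i n) ≤ s} +
        #{i : Fin n | γ i ∉ cbC t g A β i n} := by
      refine le_trans (Finset.card_le_card ?_) (Finset.card_union_le _ _)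
      intro i
      simp only [mem_filter, mem_univ, true_and, mem_union]
      tauto
    omega
  · -- columns with many small lists
    have hSJ : 5 * #{j : Fin n | n ≤ 2 * #{i : Fin n | #(A i j) ≤ s}} ≤ n := by
      rw [cb_fib' (fun i j => #(A i j) ≤ s)] at hSA
      have h2 := cb_markov univ (fun j => 2 * #{i : Fin n | #(A i j) ≤ s}) n
      rw [← Finset.mul_sum] at h2
      have : (5 * #{j : Fin n | n ≤ 2 * #{i : Fin n | #(A i j) ≤ s}}) * n ≤ n * n := by
        linarith
      exact Nat.le_of_mul_le_mul_right this hn0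
    -- columns with many violations
    have hBJ : 5 * #{j : Fin n | 5 * t * (200 * t + 1) ≤ cbW t g A β j (β j)} ≤ n := by
      have h2 := cb_markov univ (fun j => cbW t g A β j (β j)) (5 * t * (200 * t + 1))
      have h3 : ∑ j, cbW t g A β j (β j) ≤ n * (t * (200 * t + 1)) := by
        unfold cbW
        rw [Finset.sum_comm]
        have : ∀ i : Fin n, ∑ j : Fin n, #{z ∈ Finset.Icc 1 t | z ∈ cbC t g A β i j ∧
            cbV g A i j (β j) z} ≤ t * (200 * t + 1) := by
          intro i
          simp only [Finset.card_filter]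
          rw [Finset.sum_comm]
          calc _ ≤ ∑ z ∈ Finset.Icc 1 t, (200 * t + 1) := by
                apply Finset.sum_le_sum
                intro z hz
                rw [← Finset.card_filter]
                refine le_trans (Finset.card_le_card ?_) (cbD_count g A β i z (200 * t))
                intro j
                simp only [cbC, mem_filter]
                tauto
            _ = _ := by simp
        calc _ ≤ ∑ i : Fin n, t * (200 * t + 1) := Finset.sum_le_sum fun i _ => this i
          _ = _ := by simp
      have h4 := h2.trans h3
      have h5 : (5 * #{j : Fin n | 5 * t * (200 * t + 1) ≤ cbW t g A β j (β j)}) *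
          (t * (200 * t + 1)) ≤ n * (t * (200 * t + 1)) := by linarith
      exact Nat.le_of_mul_le_mul_right h5 (by positivity)
    have hgood : ∀ j : Fin n, ¬ (n ≤ 2 * #{i : Fin n | #(A i j) ≤ s}) →
        ¬ (5 * t * (200 * t + 1) ≤ cbW t g A β j (β j)) →
        β j ∈ cbY t g A β j ∧ #(cbY t g A β j) ≤ s := by
      intro j h1 h2
      refine ⟨by simp only [cbY, mem_filter, hβ j, true_and]; omega, ?_⟩
      by_contra hbig
      push Not at hbig
      -- good rows
      set GI : Finset (Fin n) := {i : Fin n | s < #(A i j) ∧ s < #(cbC t g A β i j)} with hGI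
      have hGIc : n ≤ #GI + #{i : Fin n | #(A i j) ≤ s} +
          #{i : Fin n | #(cbC t g A β i n) ≤ s} := by
        have : (univ : Finset (Fin n)) ⊆ (GI ∪ ({i : Fin n | #(A i j) ≤ s} : Finset (Fin n))) ∪
            ({i : Fin n | #(cbC t g A β i n) ≤ s} : Finset (Fin n)) := by
          intro i _
          simp only [hGI, mem_filter, mem_univ, true_and, mem_union]
          have : #(cbC t g A β i n) ≤ #(cbC t g A β i j) := by
            apply Finset.card_le_card
            intro z
            simp only [cbC, mem_filter]
            rintro ⟨h3, h4⟩
            exact ⟨h3, (cbD_mono g A β i z j.2.le).trans h4⟩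
          omega
        have h3 := Finset.card_le_card this
        rw [Finset.card_univ, Fintype.card_fin] at h3
        have h4 := Finset.card_union_le (GI ∪ ({i : Fin n | #(A i j) ≤ s} : Finset (Fin n)))
            ({i : Fin n | #(cbC t g A β i n) ≤ s} : Finset (Fin n))
        have h5 := Finset.card_union_le GI ({i : Fin n | #(A i j) ≤ s} : Finset (Fin n))
        omega
      have hlow : #GI ≤ ∑ y ∈ cbY t g A β j, cbW t g A β j y := by
        unfold cbW
        rw [Finset.sum_comm]
        calc #GI = ∑ i ∈ GI, 1 := by simp
          _ ≤ ∑ i ∈ GI, ∑ y ∈ cbY t g A β j,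
              #{z ∈ Finset.Icc 1 t | z ∈ cbC t g A β i j ∧ cbV g A i j y z} := by
              apply Finset.sum_le_sum
              intro i hi
              simp only [hGI, mem_filter, mem_univ, true_and] at hi
              obtain ⟨x, hx, y, hy, z, hz, hxyz⟩ := hred (A i j) (cbY t g A β j)
                (cbC t g A β i j) (hA i j) (filter_subset _ _) (filter_subset _ _)
                hi.1 hbig hi.2
              refine le_trans ?_ (Finset.single_le_sum (fun _ _ => Nat.zero_le _) hy)
              apply Finset.card_pos.2
              exact ⟨z, mem_filter.2 ⟨filter_subset _ _ hz, hz, x, hx, hxyz⟩⟩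
          _ ≤ _ := Finset.sum_le_sum_of_subset (subset_univ _)
      have hup : ∑ y ∈ cbY t g A β j, cbW t g A β j y ≤ t * (5 * t * (200 * t + 1)) := by
        calc _ ≤ ∑ y ∈ cbY t g A β j, (5 * t * (200 * t + 1)) := by
              apply Finset.sum_le_sum
              intro y hy
              exact (mem_filter.1 hy).2
          _ = #(cbY t g A β j) * (5 * t * (200 * t + 1)) := by simp
          _ ≤ _ := by
              apply Nat.mul_le_mul_right
              have := Finset.card_le_card (filter_subset _ _ : cbY t g A β j ⊆ Finset.Icc 1 t)
              rwa [Nat.card_Icc, Nat.add_sub_cancel] at this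
      have h6 : t * (5 * t * (200 * t + 1)) ≤ 1005 * t ^ 3 := by
        nlinarith [Nat.mul_le_mul_left (t^2) ht]
      omega
    have hcov : n ≤ #{j : Fin n | β j ∈ cbY t g A β j ∧ #(cbY t g A β j) ≤ s} +
        #{j : Fin n | n ≤ 2 * #{i : Fin n | #(A i j) ≤ s}} +
        #{j : Fin n | 5 * t * (200 * t + 1) ≤ cbW t g A β j (β j)} := by
      have : (univ : Finset (Fin n)) ⊆
          (({j : Fin n | β j ∈ cbY t g A β j ∧ #(cbY t g A β j) ≤ s} : Finset (Fin n)) ∪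
          ({j : Fin n | n ≤ 2 * #{i : Fin n | #(A i j) ≤ s}} : Finset (Fin n))) ∪
          ({j : Fin n | 5 * t * (200 * t + 1) ≤ cbW t g A β j (β j)} : Finset (Fin n)) := by
        intro j _
        have := hgood j
        simp only [mem_filter, mem_univ, true_and, mem_union]
        tauto
      have h3 := Finset.card_le_card this
      rw [Finset.card_univ, Fintype.card_fin] at h3
      refine h3.trans ((Finset.card_union_le _ _).trans ?_)
      exact Nat.add_le_add_right (Finset.card_union_le _ _) _
    omega

def cbA (t : ℕ) (g : ℕ × ℕ × ℕ → Bool) (b c : Fin n × Fin n → ℕ) (k : ℕ) (i j : Fin n) :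
    Finset ℕ :=
  {x ∈ Finset.Icc 1 t | ∀ l : Fin n, (l : ℕ) < k → g (x, b (j, l), c (i, l)) = false}

lemma cbA_congr (t : ℕ) (g : ℕ × ℕ × ℕ → Bool) (b c b' c' : Fin n × Fin n → ℕ) (k : ℕ)
    (hb : ∀ j l : Fin n, (l : ℕ) < k → b (j, l) = b' (j, l))
    (hc : ∀ i l : Fin n, (l : ℕ) < k → c (i, l) = c' (i, l)) :
    cbA t g b c k = cbA t g b' c' k := by
  funext i j
  unfold cbA
  apply Finset.filter_congr
  intro x _
  refine forall_congr' fun l => forall_congr' fun hl => ?_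
  rw [hb j l hl, hc i l hl]

/-- total number of decreasing steps -/
lemma cbA_total (t : ℕ) (g : ℕ × ℕ × ℕ → Bool) (b c : Fin n × Fin n → ℕ) :
    ∑ k : Fin n, #{p : Fin n × Fin n | cbV g (cbA t g b c k) p.1 p.2 (b (p.2, k)) (c (p.1, k))}
      ≤ n ^ 2 * t := by
  simp only [Finset.card_filter]
  rw [Finset.sum_comm]
  calc _ ≤ ∑ p : Fin n × Fin n, t := by
        apply Finset.sum_le_sum
        intro p _
        rw [← Finset.card_filter]
        have hch : ∀ k : Fin n, ∃ x, cbV g (cbA t g b c k) p.1 p.2 (b (p.2, k)) (c (p.1, k)) →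
            x ∈ cbA t g b c k p.1 p.2 ∧ g (x, b (p.2, k), c (p.1, k)) = true := by
          intro k
          by_cases h : cbV g (cbA t g b c k) p.1 p.2 (b (p.2, k)) (c (p.1, k))
          · obtain ⟨x, hx⟩ := h
            exact ⟨x, fun _ => hx⟩
          · exact ⟨0, fun h' => absurd h' h⟩
        choose x hx using hch
        have ht : t = #(Finset.Icc 1 t) := by simp
        conv_rhs => rw [ht]
        apply Finset.card_le_card_of_injOn x
        · intro k hk
          have := (hx k (mem_filter.1 (Finset.mem_coe.1 hk)).2).1
          exact Finset.mem_coe.2 (filter_subset _ _ this)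
        · have key : ∀ k k' : Fin n, cbV g (cbA t g b c k) p.1 p.2 (b (p.2, k)) (c (p.1, k)) →
              cbV g (cbA t g b c k') p.1 p.2 (b (p.2, k')) (c (p.1, k')) → k < k' →
              x k ≠ x k' := by
            intro k k' hk hk' hlt heq
            have h1 := (hx k hk).2
            have h2 := (mem_filter.1 (hx k' hk').1).2 k hlt
            rw [heq, h2] at h1
            exact Bool.noConfusion h1
          intro k hk k' hk' h
          have hk := (mem_filter.1 (Finset.mem_coe.1 hk)).2
          have hk' := (mem_filter.1 (Finset.mem_coe.1 hk')).2
          rcases lt_trichotomy k k' with h' | h' | h'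
          · exact absurd h (key _ _ hk hk' h')
          · exact h'
          · exact absurd h.symm (key _ _ hk' hk h')
    _ = _ := by simp [sq]

/-- index type of all the pairs -/
abbrev CbI (n : ℕ) := (Fin n × Fin n) ⊕ ((Fin n × Fin n) ⊕ (Fin n × Fin n))

def cbRank : CbI n → ℕ
  | .inl _ => n * (n + 1)
  | .inr (.inl q) => (q.2 : ℕ) * (n + 1) + q.1
  | .inr (.inr q) => (q.2 : ℕ) * (n + 1) + n

def cbS (t : ℕ) (g : ℕ × ℕ × ℕ → Bool) : CbI n → (CbI n → ℕ) → Finset ℕ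
  | .inl q, f => cbA t g (fun q => f (.inr (.inl q))) (fun q => f (.inr (.inr q))) n q.1 q.2
  | .inr (.inl q), f =>
      cbY t g (cbA t g (fun q => f (.inr (.inl q))) (fun q => f (.inr (.inr q))) q.2)
        (fun j => f (.inr (.inl (j, q.2)))) q.1
  | .inr (.inr q), f =>
      cbC t g (cbA t g (fun q => f (.inr (.inl q))) (fun q => f (.inr (.inr q))) q.2)
        (fun j => f (.inr (.inl (j, q.2)))) q.1 n

lemma cbRank_aux {l k N x y : ℕ} (h : l < k) (hx : x < N) : l * N + x < k * N + y := by
  have : (l + 1) * N ≤ k * N := Nat.mul_le_mul_right _ h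
  linarith

lemma cbS_congr (t : ℕ) (g : ℕ × ℕ × ℕ → Bool) (e : CbI n) (f f' : CbI n → ℕ)
    (h : ∀ e', cbRank e' < cbRank e → f e' = f' e') : cbS t g e f = cbS t g e f' := by
  have hAk : ∀ k : ℕ, k * (n + 1) ≤ cbRank e →
      cbA t g (fun q => f (.inr (.inl q))) (fun q => f (.inr (.inr q))) k =
      cbA t g (fun q => f' (.inr (.inl q))) (fun q => f' (.inr (.inr q))) k := by
    intro k hk
    apply cbA_congr
    · intro j l hl
      apply h
      refine lt_of_lt_of_le ?_ hk
      have := cbRank_aux (N := n + 1) (x := j) (y := 0) hl (by omega)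
      simpa [cbRank] using this
    · intro j l hl
      apply h
      refine lt_of_lt_of_le ?_ hk
      have := cbRank_aux (N := n + 1) (x := n) (y := 0) hl (by omega)
      simpa [cbRank] using this
  match e, h, hAk with
  | .inl q, h, hAk =>
    simp only [cbS]
    rw [hAk n (by simp [cbRank])]
  | .inr (.inl q), h, hAk =>
    simp only [cbS]
    rw [hAk q.2 (by simp [cbRank])]
    apply cbY_congr
    intro l hl
    apply h
    simpa [cbRank] using hl
  | .inr (.inr q), h, hAk =>
    simp only [cbS]
    rw [hAk q.2 (by simp [cbRank])]
    apply cbC_congr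
    intro l hl
    apply h
    simp [cbRank]

lemma cb_good (t s : ℕ) (g : ℕ × ℕ × ℕ → Bool) (ht : 1 ≤ t) (hn : 3000 * t ^ 3 ≤ n)
    (hred : ∀ X Y Z : Finset ℕ, X ⊆ Finset.Icc 1 t → Y ⊆ Finset.Icc 1 t → Z ⊆ Finset.Icc 1 t →
      s < #X → s < #Y → s < #Z → ∃ x ∈ X, ∃ y ∈ Y, ∃ z ∈ Z, g (x, y, z) = true)
    (f : CbI n → ℕ) (hf : ∀ e, f e ∈ Finset.Icc 1 t)
    (hg : ∀ i j k : Fin n,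
      g (f (.inl (i, j)), f (.inr (.inl (j, k))), f (.inr (.inr (i, k)))) = false) :
    n ^ 2 ≤ 40 * #{e : CbI n | f e ∈ cbS t g e f ∧ #(cbS t g e f) ≤ s} := by
  have hn0 : 0 < n := by
    have : 0 < t ^ 3 := by positivity
    omega
  set b : Fin n × Fin n → ℕ := fun q => f (.inr (.inl q)) with hb
  set c : Fin n × Fin n → ℕ := fun q => f (.inr (.inr q)) with hc
  have hsplit : #{e : CbI n | f e ∈ cbS t g e f ∧ #(cbS t g e f) ≤ s} =
      #{p : Fin n × Fin n | f (.inl p) ∈ cbA t g b c n p.1 p.2 ∧ #(cbA t g b c n p.1 p.2) ≤ s} +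
      (∑ k : Fin n, #{j : Fin n | b (j, k) ∈ cbY t g (cbA t g b c k) (fun j => b (j, k)) j ∧
        #(cbY t g (cbA t g b c k) (fun j => b (j, k)) j) ≤ s} +
      ∑ k : Fin n, #{i : Fin n | c (i, k) ∈ cbC t g (cbA t g b c k) (fun j => b (j, k)) i n ∧
        #(cbC t g (cbA t g b c k) (fun j => b (j, k)) i n) ≤ s}) := by
    simp only [Finset.card_filter, Fintype.sum_sum_type, Fintype.sum_prod_type_right]
    rfl
  rw [hsplit]
  by_cases hSA : 10 * #{p : Fin n × Fin n | #(cbA t g b c n p.1 p.2) ≤ s} ≤ n ^ 2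
  · -- good `k`
    have hbad : 10 * #{k : Fin n | 10 * n * t ≤ #{p : Fin n × Fin n |
        cbV g (cbA t g b c k) p.1 p.2 (b (p.2, k)) (c (p.1, k))}} ≤ n := by
      have h1 := cb_markov univ (fun k : Fin n => #{p : Fin n × Fin n |
        cbV g (cbA t g b c k) p.1 p.2 (b (p.2, k)) (c (p.1, k))}) (10 * n * t)
      have h2 := h1.trans (cbA_total t g b c)
      refine Nat.le_of_mul_le_mul_right (c := n * t) ?_ (by positivity)
      linarith
    set B : Finset (Fin n) := {k : Fin n | 10 * n * t ≤ #{p : Fin n × Fin n |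
        cbV g (cbA t g b c k) p.1 p.2 (b (p.2, k)) (c (p.1, k))}} with hB
    have hk : ∀ k ∈ Bᶜ, n ≤ 20 *
        (#{i : Fin n | c (i, k) ∈ cbC t g (cbA t g b c k) (fun j => b (j, k)) i n ∧
          #(cbC t g (cbA t g b c k) (fun j => b (j, k)) i n) ≤ s} +
        #{j : Fin n | b (j, k) ∈ cbY t g (cbA t g b c k) (fun j => b (j, k)) j ∧
          #(cbY t g (cbA t g b c k) (fun j => b (j, k)) j) ≤ s}) := by
      intro k hk
      apply cb_step t s g ht hn hred (cbA t g b c k) (fun i j => filter_subset _ _)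
        (fun j => b (j, k)) (fun i => c (i, k)) (fun j => hf _) (fun i => hf _)
      · simp only [hB, mem_compl, mem_filter, mem_univ, true_and, not_le] at hk
        exact hk.le
      · refine le_trans (Nat.mul_le_mul_left _ (Finset.card_le_card ?_)) hSA
        intro p
        simp only [mem_filter, mem_univ, true_and]
        intro h
        refine le_trans (Finset.card_le_card ?_) h
        intro x
        simp only [cbA, mem_filter]
        rintro ⟨h1, h2⟩
        exact ⟨h1, fun l _ => h2 l l.2⟩
    have hsum : #Bᶜ * n ≤ 20 *
      (∑ k : Fin n, #{j : Fin n | b (j, k) ∈ cbY t g (cbA t g b c k) (fun j => b (j, k)) j ∧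
        #(cbY t g (cbA t g b c k) (fun j => b (j, k)) j) ≤ s} +
      ∑ k : Fin n, #{i : Fin n | c (i, k) ∈ cbC t g (cbA t g b c k) (fun j => b (j, k)) i n ∧
        #(cbC t g (cbA t g b c k) (fun j => b (j, k)) i n) ≤ s}) := by
      rw [← smul_eq_mul (#Bᶜ), add_comm (∑ k : Fin n, _), ← Finset.sum_add_distrib,
        Finset.mul_sum]
      exact (Finset.card_nsmul_le_sum _ _ _ hk).trans
        (Finset.sum_le_sum_of_subset (subset_univ _))
    have hBc : #Bᶜ + #B = n := by
      have := Finset.card_compl_add_card B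
      simpa using this
    have : n * n ≤ 2 * (#Bᶜ * n) := by
      have : n ≤ 2 * #Bᶜ := by omega
      have := Nat.mul_le_mul_right n this
      linarith
    rw [sq]
    omega
  · have : #{p : Fin n × Fin n | #(cbA t g b c n p.1 p.2) ≤ s} ≤
        #{p : Fin n × Fin n | f (.inl p) ∈ cbA t g b c n p.1 p.2 ∧
          #(cbA t g b c n p.1 p.2) ≤ s} := by
      apply Finset.card_le_card
      intro p
      simp only [mem_filter, mem_univ, true_and]
      intro h
      refine ⟨?_, h⟩
      simp only [cbA, mem_filter]
      exact ⟨hf _, fun l _ => hg p.1 p.2 l⟩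
    omega

lemma cb_count (t s m : ℕ) (g : ℕ × ℕ × ℕ → Bool) (ht : 1 ≤ t) (hn : 3000 * t ^ 3 ≤ n)
    (hred : ∀ X Y Z : Finset ℕ, X ⊆ Finset.Icc 1 t → Y ⊆ Finset.Icc 1 t → Z ⊆ Finset.Icc 1 t →
      s < #X → s < #Y → s < #Z → ∃ x ∈ X, ∃ y ∈ Y, ∃ z ∈ Z, g (x, y, z) = true)
    (hm : 40 * m < n ^ 2 + 40) :
    Set.ncard {F : (Fin n × Fin n → ℕ) × (Fin n × Fin n → ℕ) × (Fin n × Fin n → ℕ) |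
              (∀ q : Fin n × Fin n, F.1 q ∈ Finset.Icc 1 t ∧ F.2.1 q ∈ Finset.Icc 1 t ∧
                F.2.2 q ∈ Finset.Icc 1 t) ∧
              ∀ i j k : Fin n, g (F.1 (i, j), F.2.1 (j, k), F.2.2 (i, k)) = false}
      ≤ 2 ^ (3 * n ^ 2) * (s ^ m * t ^ (3 * n ^ 2 - m)) := by
  have hcard : Fintype.card (CbI n) = 3 * n ^ 2 := by
    simp [CbI]; ring
  rw [← hcard]
  let Φ : (Fin n × Fin n → ℕ) × (Fin n × Fin n → ℕ) × (Fin n × Fin n → ℕ) → (CbI n → ℕ) :=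
    fun F => Sum.elim F.1 (Sum.elim F.2.1 F.2.2)
  have hΦ : Function.Injective Φ := by
    rintro ⟨a, b, c⟩ ⟨a', b', c'⟩ h
    have h1 : a = a' := funext fun q => congrFun h (.inl q)
    have h2 : b = b' := funext fun q => congrFun h (.inr (.inl q))
    have h3 : c = c' := funext fun q => congrFun h (.inr (.inr q))
    rw [h1, h2, h3]
  rw [← Set.ncard_image_of_injective _ hΦ]
  apply cb_enc cbRank (cbS t g) (cbS_congr t g)
  rintro f ⟨F, ⟨hF1, hF2⟩, rfl⟩
  have hf : ∀ e, Φ F e ∈ Finset.Icc 1 t := by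
    rintro (q | q | q)
    · exact (hF1 q).1
    · exact (hF1 q).2.1
    · exact (hF1 q).2.2
  refine ⟨hf, ?_⟩
  have := cb_good t s g ht hn hred (Φ F) hf hF2
  omega

end CountBlue

/-- For every sufficiently small `ε > 0` there is `n₀` such that for all
`n ≥ n₀`, with `t = ⌊n^ε⌋`: for any `g : [t]³ → {red, blue}` (`true` = red, `false` = blue)
such that any `X, Y, Z ⊆ [t]` of size at least `t^{1-ε}` contain a red triple, the number of
triples of functions `(a, b, c)`, each from `[n] × [n]` to `[t]` (here modelled as functions
`Fin n × Fin n → ℕ` with values in `[t] = {1,…,t}`), with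
`g (a (i,j), b (j,k), c (i,k))` blue for all `i, j, k`, is at most `t^{(3 - ε/50) n²}`. -/
theorem count_blue_function_triples :
    ∃ ε₀ : ℝ, ε₀ > 0 ∧ ∀ ε : ℝ, 0 < ε → ε ≤ ε₀ →
      ∃ n₀ : ℕ, ∀ n : ℕ, n₀ ≤ n → ∀ t : ℕ, t = ⌊(n : ℝ) ^ ε⌋₊ →
        ∀ g : ℕ × ℕ × ℕ → Bool,
          (∀ X Y Z : Finset ℕ, X ⊆ Finset.Icc 1 t → Y ⊆ Finset.Icc 1 t →
            Z ⊆ Finset.Icc 1 t →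
            (t : ℝ) ^ (1 - ε) ≤ (X.card : ℝ) → (t : ℝ) ^ (1 - ε) ≤ (Y.card : ℝ) →
            (t : ℝ) ^ (1 - ε) ≤ (Z.card : ℝ) →
            ∃ x ∈ X, ∃ y ∈ Y, ∃ z ∈ Z, g (x, y, z) = true) →
          (Set.ncard {F : (Fin n × Fin n → ℕ) × (Fin n × Fin n → ℕ) × (Fin n × Fin n → ℕ) |
              (∀ q : Fin n × Fin n, F.1 q ∈ Finset.Icc 1 t ∧ F.2.1 q ∈ Finset.Icc 1 t ∧
                F.2.2 q ∈ Finset.Icc 1 t) ∧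
              ∀ i j k : Fin n, g (F.1 (i, j), F.2.1 (j, k), F.2.2 (i, k)) = false} : ℝ) ≤
            (t : ℝ) ^ (((3 : ℝ) - ε / 50) * (n : ℝ) ^ 2) := by
  refine ⟨1 / 4, by norm_num, fun ε hε hε4 => ?_⟩
  have hlim : Filter.Tendsto (fun n : ℕ => (n : ℝ) ^ ε) Filter.atTop Filter.atTop :=
    (tendsto_rpow_atTop hε).comp tendsto_natCast_atTop_atTop
  have hlim2 : Filter.Tendsto (fun n : ℕ => (n : ℝ) ^ (1 / 4 : ℝ)) Filter.atTop Filter.atTop :=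
    (tendsto_rpow_atTop (by norm_num)).comp tendsto_natCast_atTop_atTop
  obtain ⟨n₀, hn₀⟩ := Filter.eventually_atTop.1
    ((hlim.eventually_ge_atTop ((8 : ℝ) ^ (200 / ε) + 1)).and
      ((hlim2.eventually_ge_atTop 3000).and (Filter.eventually_ge_atTop 1)))
  refine ⟨n₀, fun n hn t ht g hg => ?_⟩
  obtain ⟨h1, h2, h3⟩ := hn₀ n hn
  have hn1 : (1 : ℝ) ≤ n := by exact_mod_cast h3
  have htlow : (8 : ℝ) ^ (200 / ε) ≤ t := by
    have := Nat.lt_floor_add_one ((n : ℝ) ^ ε)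
    rw [← ht] at this
    linarith
  have hte : (8 : ℝ) ≤ (t : ℝ) ^ (ε / 200) := by
    have h := Real.rpow_le_rpow (by positivity) htlow (by positivity : 0 ≤ ε / 200)
    rw [← Real.rpow_mul (by norm_num)] at h
    have e : 200 / ε * (ε / 200) = 1 := by field_simp
    rwa [e, Real.rpow_one] at h
  have ht1R : (1 : ℝ) ≤ t := le_trans (Real.one_le_rpow (by norm_num) (by positivity)) htlow
  have ht1 : 1 ≤ t := by exact_mod_cast ht1R
  have ht0 : (0 : ℝ) < t := by linarith
  have htup : (t : ℝ) ≤ (n : ℝ) ^ (1 / 4 : ℝ) := by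
    rw [ht]
    exact (Nat.floor_le (by positivity)).trans (Real.rpow_le_rpow_of_exponent_le hn1 hε4)
  have hnt : 3000 * t ^ 3 ≤ n := by
    have e : ((n : ℝ) ^ (1 / 4 : ℝ)) * ((n : ℝ) ^ (1 / 4 : ℝ)) ^ 3 = n := by
      rw [← pow_succ', ← Real.rpow_natCast, ← Real.rpow_mul (by positivity)]
      norm_num
    have : (3000 : ℝ) * (t : ℝ) ^ 3 ≤ n := by
      calc (3000 : ℝ) * (t : ℝ) ^ 3 ≤
            ((n : ℝ) ^ (1 / 4 : ℝ)) * ((n : ℝ) ^ (1 / 4 : ℝ)) ^ 3 := by gcongr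
        _ = (n : ℝ) := e
    exact_mod_cast this
  have hpos : (0 : ℝ) < (t : ℝ) ^ (1 - ε) := Real.rpow_pos_of_pos ht0 _
  have hceil : 0 < ⌈(t : ℝ) ^ (1 - ε)⌉₊ := Nat.ceil_pos.2 hpos
  obtain ⟨s, hs⟩ : ∃ s, s + 1 = ⌈(t : ℝ) ^ (1 - ε)⌉₊ := ⟨_, Nat.sub_add_cancel hceil⟩
  have hsle : (s : ℝ) ≤ (t : ℝ) ^ (1 - ε) := (Nat.lt_ceil.1 (by omega)).le
  have hlarge : ∀ X : Finset ℕ, s < X.card → (t : ℝ) ^ (1 - ε) ≤ (X.card : ℝ) := by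
    intro X hX
    exact Nat.ceil_le.1 (by omega)
  obtain ⟨m, hm1, hm2⟩ : ∃ m : ℕ, n ^ 2 ≤ 40 * m ∧ 40 * m < n ^ 2 + 40 :=
    ⟨(n ^ 2 + 39) / 40, by omega, by omega⟩
  have hn2 : 1 ≤ n ^ 2 := Nat.one_le_pow _ _ h3
  have hm3 : m ≤ 3 * n ^ 2 := by omega
  have hmain := cb_count t s m g ht1 hnt
    (fun X Y Z hX hY hZ h1 h2 h3 => hg X Y Z hX hY hZ (hlarge X h1) (hlarge Y h2) (hlarge Z h3)) hm2
  have hm1R : (n : ℝ) ^ 2 ≤ 40 * m := by exact_mod_cast hm1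
  refine (Nat.cast_le.2 hmain).trans ?_
  push_cast
  calc (2 : ℝ) ^ (3 * n ^ 2) * ((s : ℝ) ^ m * (t : ℝ) ^ (3 * n ^ 2 - m))
      ≤ ((t : ℝ) ^ (ε / 200)) ^ (n ^ 2) *
        (((t : ℝ) ^ (1 - ε)) ^ m * (t : ℝ) ^ (3 * n ^ 2 - m)) := by
        rw [pow_mul]
        norm_num only
        gcongr
    _ = (t : ℝ) ^ (ε / 200 * (n : ℝ) ^ 2 + ((1 - ε) * m + (3 * (n : ℝ) ^ 2 - m))) := by
        rw [Real.rpow_add ht0, Real.rpow_add ht0, Real.rpow_mul ht0.le, Real.rpow_mul ht0.le]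
        rw [← Real.rpow_natCast (t : ℝ) (3 * n ^ 2 - m), Nat.cast_sub hm3]
        rw [← Real.rpow_natCast _ m, ← Real.rpow_natCast _ (n ^ 2)]
        push_cast
        rfl
    _ ≤ (t : ℝ) ^ (((3 : ℝ) - ε / 50) * (n : ℝ) ^ 2) := by
        apply Real.rpow_le_rpow_of_exponent_le ht1R
        nlinarith [mul_le_mul_of_nonneg_left hm1R hε.le]
end
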